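/- arXiv:2106.14759 — 2 statements merged into one kernel-verified Lean document; each statement's English description precedes it below -/
import Mathlib

section
/- (Francisco) Let f ⊆ A = K[x_1,…,x_n] be an ideal generated by a homogeneous regular sequence of degree a = (a_1,…,a_r), and let g ∉ f be a homogeneous element of degree D ≥ a_1. Then the almost complete intersection I = f + (g) satisfies EGH_a(D): there exists an a-lpp ideal J with dim_K J_D = dim_K I_D and dim_K J_{D+1} ≤ dim_K I_{D+1}. -/
open MvPolynomial

section Defs

variable {K : Type*} [Field K]

/-- Total degree of an exponent vector. -/
def expDeg {n : ℕ} (m : Fin n →₀ ℕ) : ℕ := ∑ i, m i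

/-- `lexLe m m'` means `m ≤ m'` in the lexicographic order with `x_1 > x_2 > … > x_n`. -/
def lexLe {n : ℕ} (m m' : Fin n →₀ ℕ) : Prop :=
  m = m' ∨ ∃ i : Fin n, (∀ j : Fin n, j < i → m j = m' j) ∧ m i < m' i

/-- A lex-segment in degree `d`: an upward (w.r.t. lex) closed set of degree-`d`
exponent vectors. -/
def IsLexSegment (n d : ℕ) (S : Set (Fin n →₀ ℕ)) : Prop :=
  (∀ m ∈ S, expDeg m = d) ∧
    ∀ m ∈ S, ∀ m' : Fin n →₀ ℕ, expDeg m' = d → lexLe m m' → m' ∈ S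

/-- The pure-powers ideal `(x_1^{a_1}, …, x_r^{a_r})`. -/
noncomputable def purePowers (K : Type*) [Field K] {n r : ℕ} (hrn : r ≤ n)
    (a : Fin r → ℕ) : Ideal (MvPolynomial (Fin n) K) :=
  Ideal.span (Set.range fun i : Fin r => X (Fin.castLE hrn i) ^ a i)

/-- A homogeneous ideal. -/
def IsHomog {n : ℕ} (I : Ideal (MvPolynomial (Fin n) K)) : Prop :=
  ∀ f ∈ I, ∀ d : ℕ, homogeneousComponent d f ∈ I

/-- The degree-`d` component of an ideal, as a `K`-subspace. -/
noncomputable def component {n : ℕ} (I : Ideal (MvPolynomial (Fin n) K)) (d : ℕ) :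
    Submodule K (MvPolynomial (Fin n) K) :=
  Submodule.restrictScalars K I ⊓ homogeneousSubmodule (Fin n) K d

/-- Hilbert function of an ideal: `dim_K I_d`. -/
noncomputable def hilb {n : ℕ} (I : Ideal (MvPolynomial (Fin n) K)) (d : ℕ) : ℕ :=
  Module.finrank K ↥(component I d)

/-- An `a`-lpp (lex-plus-powers) ideal: a homogeneous (monomial) ideal each of whose graded
components is the span of a lex-segment plus the corresponding component of the
pure-powers ideal. -/
def IsLPP {n r : ℕ} (hrn : r ≤ n) (a : Fin r → ℕ)
    (J : Ideal (MvPolynomial (Fin n) K)) : Prop :=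
  IsHomog J ∧
    ∀ d : ℕ, ∃ S : Set (Fin n →₀ ℕ), IsLexSegment n d S ∧
      component J d =
        Submodule.span K ((fun m => (monomial m (1 : K) : MvPolynomial (Fin n) K)) '' S)
          ⊔ component (purePowers K hrn a) d

/-- `I` satisfies `EGH_a(d)`. -/
def EGHd {n r : ℕ} (hrn : r ≤ n) (a : Fin r → ℕ)
    (I : Ideal (MvPolynomial (Fin n) K)) (d : ℕ) : Prop :=
  ∃ J : Ideal (MvPolynomial (Fin n) K), IsLPP hrn a J ∧
    hilb J d = hilb I d ∧ hilb J (d + 1) ≤ hilb I (d + 1)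

/-- `I` satisfies `EGH_a`. -/
def EGH {n r : ℕ} (hrn : r ≤ n) (a : Fin r → ℕ)
    (I : Ideal (MvPolynomial (Fin n) K)) : Prop :=
  ∀ d : ℕ, EGHd hrn a I d

/-- A monomial ideal. -/
def IsMonomialIdeal {n : ℕ} (I : Ideal (MvPolynomial (Fin n) K)) : Prop :=
  ∃ M : Set (Fin n →₀ ℕ),
    I = Ideal.span ((fun m => (monomial m (1 : K) : MvPolynomial (Fin n) K)) '' M)

/-- A strongly stable (monomial) ideal. -/
def IsStronglyStable {n : ℕ} (S : Ideal (MvPolynomial (Fin n) K)) : Prop :=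
  IsMonomialIdeal S ∧
    ∀ (m : Fin n →₀ ℕ) (i j : Fin n), j ≤ i →
      (monomial (m + Finsupp.single i 1) (1 : K) : MvPolynomial (Fin n) K) ∈ S →
      (monomial (m + Finsupp.single j 1) (1 : K) : MvPolynomial (Fin n) K) ∈ S

/-- An `a`-spp (strongly-stable-plus-powers) ideal. -/
def IsSPP {n r : ℕ} (hrn : r ≤ n) (a : Fin r → ℕ)
    (J : Ideal (MvPolynomial (Fin n) K)) : Prop :=
  ∃ S : Ideal (MvPolynomial (Fin n) K), IsStronglyStable S ∧ J = S ⊔ purePowers K hrn a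

/-- A regular sequence: each `f i` is a non-zerodivisor modulo `(f j : j < i)`. -/
def IsRegSeq {n r : ℕ} (f : Fin r → MvPolynomial (Fin n) K) : Prop :=
  ∀ i : Fin r, ∀ g : MvPolynomial (Fin n) K,
    g * f i ∈ Ideal.span { p | ∃ j : Fin r, j < i ∧ p = f j } →
    g ∈ Ideal.span { p | ∃ j : Fin r, j < i ∧ p = f j }

/-- `I` contains a homogeneous regular sequence of degree `a`. -/
def ContainsRegSeq {n r : ℕ} (a : Fin r → ℕ)
    (I : Ideal (MvPolynomial (Fin n) K)) : Prop :=
  ∃ f : Fin r → MvPolynomial (Fin n) K,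
    (∀ i, f i ∈ I) ∧ IsRegSeq f ∧ ∀ i, (f i).IsHomogeneous (a i)

/-- `dim_K (N/P)` for ideals `P ≤ N` (the `K`-dimension of `N/(N ∩ P)`). -/
noncomputable def quotDim (K : Type*) [Field K] {n : ℕ}
    (N P : Ideal (MvPolynomial (Fin n) K)) : ℕ :=
  Module.finrank K
    (↥(Submodule.restrictScalars K N) ⧸
      Submodule.comap (Submodule.restrictScalars K N).subtype (Submodule.restrictScalars K P))

/-- `dim_K (I/F)_d`. -/
noncomputable def relHilb {n : ℕ} (I F : Ideal (MvPolynomial (Fin n) K)) (d : ℕ) : ℕ :=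
  Module.finrank K
    (↥(component I d) ⧸ Submodule.comap (component I d).subtype (Submodule.restrictScalars K F))

/-- `dim_K (A/I)_d`. -/
noncomputable def hilbQ {n : ℕ} (I : Ideal (MvPolynomial (Fin n) K)) (d : ℕ) : ℕ :=
  Module.finrank K
    (↥(homogeneousSubmodule (Fin n) K d) ⧸
      Submodule.comap (homogeneousSubmodule (Fin n) K d).subtype (Submodule.restrictScalars K I))

end Defs

section Koszul

/-- Index type for a basis of the exterior algebra on `t` generators: `inl s` omits the last
generator, `inr s` contains it. -/
inductive KoszulIndex : ℕ → Type
  | nil : KoszulIndex 0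
  | inl {t : ℕ} (s : KoszulIndex t) : KoszulIndex (t + 1)
  | inr {t : ℕ} (s : KoszulIndex t) : KoszulIndex (t + 1)

namespace KoszulIndex

/-- The exterior degree of a basis element. -/
def level : {t : ℕ} → KoszulIndex t → ℕ
  | _, .nil => 0
  | _, .inl s => level s
  | _, .inr s => level s + 1

lemma level_le : {t : ℕ} → (s : KoszulIndex t) → level s ≤ t
  | _, .nil => le_rfl
  | _, .inl s => (level_le s).trans (Nat.le_succ _)
  | _, .inr s => Nat.succ_le_succ (level_le s)

lemma exists_level_eq : (t : ℕ) → ∃ s : KoszulIndex t, level s = t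
  | 0 => ⟨.nil, rfl⟩
  | t + 1 => by
    obtain ⟨s, hs⟩ := exists_level_eq t
    exact ⟨.inr s, congrArg (· + 1) hs⟩

end KoszulIndex

open KoszulIndex

variable {R : Type*}

/-- The element of the exterior algebra on `t + 1` generators with the given components. -/
def koszulJoin {t : ℕ} (α β : KoszulIndex t → R) : KoszulIndex (t + 1) → R
  | .inl s => α s
  | .inr s => β s

@[simp] lemma koszulJoin_inl {t : ℕ} (α β : KoszulIndex t → R) (s : KoszulIndex t) :
    koszulJoin α β (.inl s) = α s := rfl

@[simp] lemma koszulJoin_inr {t : ℕ} (α β : KoszulIndex t → R) (s : KoszulIndex t) :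
    koszulJoin α β (.inr s) = β s := rfl

variable [CommRing R]

/-- The Koszul differential on the exterior algebra on `t` generators, sending the `j`-th
generator to `ℓ j`. -/
def koszulD (ℓ : ℕ → R) : (t : ℕ) → (KoszulIndex t → R) →ₗ[R] (KoszulIndex t → R)
  | 0 => 0
  | t + 1 =>
    { toFun := fun ω => koszulJoin
        (koszulD ℓ t (fun s => ω (.inl s)) + ℓ t • fun s => ω (.inr s))
        (-koszulD ℓ t (fun s => ω (.inr s)))
      map_add' := fun ω η => by
        have h1 := (koszulD ℓ t).map_add (fun s => ω (.inl s)) (fun s => η (.inl s))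
        have h2 := (koszulD ℓ t).map_add (fun s => ω (.inr s)) (fun s => η (.inr s))
        funext s
        rcases s with _ | s | s
        · have := congrFun h1 s
          simp only [Pi.add_def, koszulJoin_inl, Pi.smul_apply, smul_eq_mul] at this ⊢
          rw [this]; ring
        · have := congrFun h2 s
          simp only [Pi.add_def, koszulJoin_inr, Pi.neg_apply] at this ⊢
          rw [this]; ring
      map_smul' := fun c ω => by
        have h1 := (koszulD ℓ t).map_smul c (fun s => ω (.inl s))
        have h2 := (koszulD ℓ t).map_smul c (fun s => ω (.inr s))
        funext s
        rcases s with _ | s | s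
        · have := congrFun h1 s
          simp only [Pi.add_apply, koszulJoin_inl, Pi.smul_def, smul_eq_mul,
            RingHom.id_apply] at this ⊢
          rw [this]; ring
        · have := congrFun h2 s
          simp only [koszulJoin_inr, Pi.neg_apply, Pi.smul_def, smul_eq_mul,
            RingHom.id_apply] at this ⊢
          rw [this]; ring }

variable (ℓ : ℕ → R)

lemma koszulD_inl {t : ℕ} (ω : KoszulIndex (t + 1) → R) (s : KoszulIndex t) :
    koszulD ℓ (t + 1) ω (.inl s) =
      koszulD ℓ t (fun s => ω (.inl s)) s + ℓ t * ω (.inr s) := rfl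

lemma koszulD_inr {t : ℕ} (ω : KoszulIndex (t + 1) → R) (s : KoszulIndex t) :
    koszulD ℓ (t + 1) ω (.inr s) = -koszulD ℓ t (fun s => ω (.inr s)) s := rfl

/-- `ω` is supported in exterior degree `i`. -/
def OnLevel {t : ℕ} (i : ℕ) (ω : KoszulIndex t → R) : Prop :=
  ∀ s, level s ≠ i → ω s = 0

variable {ℓ}

lemma OnLevel.inl {t i : ℕ} {ω : KoszulIndex (t + 1) → R} (h : OnLevel i ω) :
    OnLevel i (fun s : KoszulIndex t => ω (.inl s)) :=
  fun s hs => h (.inl s) hs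

lemma OnLevel.inr {t i : ℕ} {ω : KoszulIndex (t + 1) → R} (h : OnLevel (i + 1) ω) :
    OnLevel i (fun s : KoszulIndex t => ω (.inr s)) :=
  fun s hs => h (.inr s) fun h' => hs (Nat.succ_injective h')

lemma OnLevel.inr_zero {t : ℕ} {ω : KoszulIndex (t + 1) → R} (h : OnLevel 0 ω)
    (s : KoszulIndex t) : ω (.inr s) = 0 :=
  h (.inr s) (Nat.succ_ne_zero _)

lemma OnLevel.elim {t i : ℕ} {α β : KoszulIndex t → R} (hα : OnLevel (i + 1) α)
    (hβ : OnLevel i β) :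
    OnLevel (i + 1) (koszulJoin α β) := by
  rintro (_ | s | s) hs
  · exact hα s hs
  · exact hβ s fun h => hs (congrArg (· + 1) h)

lemma OnLevel.eq_zero_of_lt {t i : ℕ} {ω : KoszulIndex t → R} (h : OnLevel i ω) (hi : t < i) :
    ω = 0 :=
  funext fun s => h s ((level_le s).trans_lt hi).ne

lemma koszulD_koszulD : (t : ℕ) → (ω : KoszulIndex t → R) → koszulD ℓ t (koszulD ℓ t ω) = 0
  | 0, _ => rfl
  | t + 1, ω => by
    have h1 := koszulD_koszulD t
    funext s
    rcases s with _ | s | s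
    · rw [koszulD_inl, koszulD_inr]
      have : (fun s => koszulD ℓ (t + 1) ω (.inl s)) =
          koszulD ℓ t (fun s => ω (.inl s)) + ℓ t • fun s => ω (.inr s) := rfl
      rw [this, map_add, map_smul, h1]
      simp
    · rw [koszulD_inr]
      have : (fun s => koszulD ℓ (t + 1) ω (.inr s)) = -koszulD ℓ t (fun s => ω (.inr s)) := rfl
      rw [this, map_neg, h1]
      simp

lemma koszulD_eq_zero_of_onLevel_zero :
    ∀ {t : ℕ} {ω : KoszulIndex t → R}, OnLevel 0 ω → koszulD ℓ t ω = 0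
  | 0, _, _ => rfl
  | t + 1, ω, h => by
    have h2 : (fun s : KoszulIndex t => ω (.inr s)) = 0 := funext h.inr_zero
    funext s
    rcases s with _ | s | s
    · rw [koszulD_inl, koszulD_eq_zero_of_onLevel_zero h.inl, h.inr_zero]
      simp
    · rw [koszulD_inr, h2]
      simp

lemma OnLevel.koszulD : ∀ {t i : ℕ} {ω : KoszulIndex t → R}, OnLevel (i + 1) ω →
    OnLevel i (koszulD ℓ t ω)
  | 0, _, _, _ => fun _ _ => rfl
  | t + 1, i, ω, h => by
    rintro (_ | s | s) hs
    · rw [koszulD_inl, h.inl.koszulD s hs, h (.inr s) fun h' => hs (Nat.succ_injective h')]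
      simp
    · rw [koszulD_inr]
      rcases i with _ | i
      · rw [koszulD_eq_zero_of_onLevel_zero h.inr]
        simp
      · rw [h.inr.koszulD s fun h' => hs (congrArg (· + 1) h')]
        simp

lemma koszulD_mem {I : Ideal R} : ∀ {t : ℕ} {ω : KoszulIndex t → R},
    (∀ j < t, ∀ s, ℓ j * ω s ∈ I) → ∀ s, koszulD ℓ t ω s ∈ I
  | 0, _, _, _ => I.zero_mem
  | t + 1, ω, h, .inl s => by
    rw [koszulD_inl]
    exact I.add_mem (koszulD_mem (fun j hj s => h j (by omega) _) s) (h t (by omega) _)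
  | t + 1, ω, h, .inr s => by
    rw [koszulD_inr]
    exact I.neg_mem (koszulD_mem (fun j hj s => h j (by omega) _) s)

lemma koszulD_mem_of_forall_mem {I : Ideal R} {t : ℕ} {ω : KoszulIndex t → R}
    (h : ∀ s, ω s ∈ I) (s : KoszulIndex t) : koszulD ℓ t ω s ∈ I :=
  koszulD_mem (fun _ _ s => I.mul_mem_left _ (h s)) s

lemma koszulD_mem_span (t : ℕ) (ω : KoszulIndex t → R) (s : KoszulIndex t) :
    koszulD ℓ t ω s ∈ Ideal.span (ℓ '' Set.Iio t) :=
  koszulD_mem (fun _ hj _ => Ideal.mul_mem_right _ _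
    (Ideal.subset_span (Set.mem_image_of_mem ℓ (Set.mem_Iio.mpr hj)))) s

lemma exists_koszulD_eq_of_mem_span : ∀ {t : ℕ} {ω : KoszulIndex t → R}, OnLevel 0 ω →
    (∀ s, ω s ∈ Ideal.span (ℓ '' Set.Iio t)) → ∃ η, OnLevel 1 η ∧ koszulD ℓ t η = ω
  | 0, ω, _, hm => by
    refine ⟨0, fun _ _ => rfl, funext fun s => ?_⟩
    have := hm s
    simp at this
    simp [this]
  | t + 1, ω, h, hm => by
    have key : ∀ s : KoszulIndex t, ∃ y, ω (.inl s) - ℓ t * y ∈ Ideal.span (ℓ '' Set.Iio t) ∧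
        (level s ≠ 0 → y = 0) := by
      intro s
      by_cases hs : level s = 0
      · have h1 := hm (.inl s)
        have h2 : Set.Iio (t + 1) = insert t (Set.Iio t) := by ext; simp
        rw [h2, Set.image_insert_eq, Ideal.mem_span_insert] at h1
        obtain ⟨y, z, hz, h1⟩ := h1
        refine ⟨y, ?_, fun h => absurd hs h⟩
        rw [h1, mul_comm]
        simpa using hz
      · exact ⟨0, by rw [h (.inl s) hs]; simp, fun _ => rfl⟩
    choose y hy hy0 using key
    have hyl : OnLevel 0 y := fun s hs => hy0 s hs
    obtain ⟨γ, hγ, hγd⟩ := exists_koszulD_eq_of_mem_span (t := t)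
      (ω := fun s => ω (.inl s) - ℓ t * y s)
      (fun s hs => by simp [h (.inl s) hs, hy0 s hs]) hy
    refine ⟨koszulJoin γ y, hγ.elim hyl, funext fun s => ?_⟩
    rcases s with _ | s | s
    · rw [koszulD_inl]
      have := congrFun hγd s
      simp only [koszulJoin_inl, koszulJoin_inr] at this ⊢
      rw [this]; ring
    · rw [koszulD_inr, h.inr_zero]
      have := congrFun (koszulD_eq_zero_of_onLevel_zero (ℓ := ℓ) hyl) s
      simp only [koszulJoin_inr]
      rw [this]; simp

/-- The Koszul complex of a regular sequence is exact in positive exterior degrees. -/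
lemma exists_koszulD_eq : ∀ {t : ℕ}
    (_ : ∀ j < t, ∀ x, ℓ j * x ∈ Ideal.span (ℓ '' Set.Iio j) → x ∈ Ideal.span (ℓ '' Set.Iio j))
    {i : ℕ} {ω : KoszulIndex t → R}, OnLevel (i + 1) ω → koszulD ℓ t ω = 0 →
    ∃ η, OnLevel (i + 2) η ∧ koszulD ℓ t η = ω
  | 0, _, i, ω, h, _ => ⟨0, fun _ _ => rfl, by rw [h.eq_zero_of_lt (by omega), map_zero]⟩
  | t + 1, hreg, i, ω, h, hd => by
    have hreg' : ∀ j < t, ∀ x, ℓ j * x ∈ Ideal.span (ℓ '' Set.Iio j) →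
        x ∈ Ideal.span (ℓ '' Set.Iio j) := fun j hj => hreg j (by omega)
    set α : KoszulIndex t → R := fun s => ω (.inl s) with hα
    set β : KoszulIndex t → R := fun s => ω (.inr s) with hβ
    have hd1 : koszulD ℓ t α + ℓ t • β = 0 := funext fun s => congrFun hd (.inl s)
    have hd2 : koszulD ℓ t β = 0 := funext fun s => neg_eq_zero.mp (congrFun hd (.inr s))
    have hβγ : ∃ γ, OnLevel (i + 1) γ ∧ koszulD ℓ t γ = β := by
      rcases i with _ | i
      · refine exists_koszulD_eq_of_mem_span h.inr fun s => hreg t (by omega) _ ?_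
        have h1 : ℓ t * β s = -koszulD ℓ t α s := by
          have := congrFun hd1 s
          simp only [Pi.add_apply, Pi.smul_apply, smul_eq_mul, Pi.zero_apply] at this
          linear_combination this
        rw [h1]
        exact neg_mem (koszulD_mem_span t α s)
      · exact exists_koszulD_eq hreg' h.inr hd2
    obtain ⟨γ, hγ, hγd⟩ := hβγ
    obtain ⟨δ, hδ, hδd⟩ := exists_koszulD_eq hreg' (i := i) (ω := α + ℓ t • γ)
      (fun s hs => by simp [h.inl s hs, hα, hγ s hs])
      (by rw [map_add, map_smul, hγd, hd1])
    have hγn : OnLevel (i + 1) (-γ) := fun s hs => by simp [hγ s hs]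
    refine ⟨koszulJoin δ (-γ), hδ.elim hγn, funext fun s => ?_⟩
    rcases s with _ | s | s
    · rw [koszulD_inl]
      have := congrFun hδd s
      simp only [koszulJoin_inl, koszulJoin_inr, Pi.add_apply, Pi.neg_apply, Pi.smul_apply,
        smul_eq_mul] at this ⊢
      rw [this]; simp [hα]
    · rw [koszulD_inr]
      have h1 : koszulD ℓ t (-γ) = -β := by rw [map_neg, hγd]
      have := congrFun h1 s
      simp only [koszulJoin_inr]
      rw [this]; simp [hβ]

end Koszul

section Graded

open KoszulIndex

variable {K σ : Type*} [Field K]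

lemma homogeneousComponent_mul_of_isHomogeneous {h : MvPolynomial σ K} {a : ℕ}
    (hh : h.IsHomogeneous a) (x : MvPolynomial σ K) (d : ℕ) :
    homogeneousComponent d (h * x) =
      if a ≤ d then h * homogeneousComponent (d - a) x else 0 := by
  have hm : ∀ i, homogeneousComponent d (h * homogeneousComponent i x) =
      if d = a + i then h * homogeneousComponent i x else 0 := fun i =>
    homogeneousComponent_of_mem (hh.mul (homogeneousComponent_isHomogeneous i x))
  conv_lhs => rw [← sum_homogeneousComponent x, Finset.mul_sum, map_sum]
  simp_rw [hm]
  split_ifs with had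
  · have : ∀ i, d = a + i ↔ d - a = i := fun i => by omega
    simp_rw [this]
    rw [Finset.sum_ite_eq]
    split_ifs with hr
    · rfl
    · rw [homogeneousComponent_eq_zero, mul_zero]
      rw [Finset.mem_range] at hr
      omega
  · exact Finset.sum_eq_zero fun i _ => if_neg (by omega)

lemma koszulD_homogeneousComponent {ℓ : ℕ → MvPolynomial σ K} :
    ∀ {t : ℕ} (_ : ∀ j < t, (ℓ j).IsHomogeneous 1) (ω : KoszulIndex t → MvPolynomial σ K) (e : ℕ)
    (s : KoszulIndex t),
    koszulD ℓ t (fun s => homogeneousComponent e (ω s)) s =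
      homogeneousComponent (e + 1) (koszulD ℓ t ω s)
  | 0, _, ω, e, s => by simp [koszulD]
  | t + 1, hℓ, ω, e, .inl s => by
    rw [koszulD_inl, koszulD_inl, map_add, homogeneousComponent_mul_of_isHomogeneous
      (hℓ t (by omega)), koszulD_homogeneousComponent (fun j hj => hℓ j (by omega))]
    simp
  | t + 1, hℓ, ω, e, .inr s => by
    rw [koszulD_inr, koszulD_inr, map_neg,
      koszulD_homogeneousComponent (fun j hj => hℓ j (by omega)) (fun s => ω (.inr s))]

end Graded

section Initial

variable {K : Type*} [Field K] {n r : ℕ}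

/-- The ideal generated by the first `k` members of the sequence `f`. -/
noncomputable def initIdeal (f : Fin r → MvPolynomial (Fin n) K) (k : ℕ) :
    Ideal (MvPolynomial (Fin n) K) :=
  Ideal.span {p | ∃ j : Fin r, (j : ℕ) < k ∧ p = f j}

lemma initIdeal_succ (f : Fin r → MvPolynomial (Fin n) K) {k : ℕ} (hk : k < r) :
    initIdeal f (k + 1) = initIdeal f k ⊔ Ideal.span {f ⟨k, hk⟩} := by
  rw [initIdeal, initIdeal, ← Ideal.span_union]
  congr 1
  ext p
  simp only [Set.mem_ofPred_eq, Set.mem_union, Set.mem_singleton_iff]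
  constructor
  · rintro ⟨j, hj, rfl⟩
    rcases Nat.lt_succ_iff_lt_or_eq.mp hj with h | h
    · exact Or.inl ⟨j, h, rfl⟩
    · exact Or.inr (congrArg f (Fin.ext h))
  · rintro (⟨j, hj, rfl⟩ | rfl)
    · exact ⟨j, by omega, rfl⟩
    · exact ⟨⟨k, hk⟩, by simp, rfl⟩

lemma initIdeal_zero (f : Fin r → MvPolynomial (Fin n) K) : initIdeal f 0 = ⊥ := by
  simp [initIdeal]

lemma initIdeal_self (f : Fin r → MvPolynomial (Fin n) K) :
    initIdeal f r = Ideal.span (Set.range f) := by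
  rw [initIdeal]
  congr 1
  ext p
  simp [eq_comm]

lemma IsRegSeq.mem_initIdeal {f : Fin r → MvPolynomial (Fin n) K} (hf : IsRegSeq f) {k : ℕ}
    (hk : k < r) {x : MvPolynomial (Fin n) K} (hx : f ⟨k, hk⟩ * x ∈ initIdeal f k) :
    x ∈ initIdeal f k :=
  hf ⟨k, hk⟩ x (by rw [mul_comm]; exact hx)

lemma IsHomog.sup {I J : Ideal (MvPolynomial (Fin n) K)} (hI : IsHomog I) (hJ : IsHomog J) :
    IsHomog (I ⊔ J) := by
  intro x hx d
  obtain ⟨y, hy, z, hz, rfl⟩ := Submodule.mem_sup.mp hx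
  rw [map_add]
  exact Submodule.add_mem_sup (hI y hy d) (hJ z hz d)

lemma isHomog_span_singleton {h : MvPolynomial (Fin n) K} {a : ℕ} (hh : h.IsHomogeneous a) :
    IsHomog (Ideal.span {h}) := by
  intro x hx d
  obtain ⟨y, rfl⟩ := Ideal.mem_span_singleton'.mp hx
  rw [mul_comm, homogeneousComponent_mul_of_isHomogeneous hh]
  split_ifs
  · exact Ideal.mul_mem_right _ _ (Ideal.mem_span_singleton_self h)
  · exact Ideal.zero_mem _

lemma isHomog_initIdeal {f : Fin r → MvPolynomial (Fin n) K} {a : Fin r → ℕ}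
    (hdeg : ∀ i, (f i).IsHomogeneous (a i)) {k : ℕ} (hk : k ≤ r) : IsHomog (initIdeal f k) := by
  induction k with
  | zero =>
    rw [initIdeal_zero]
    intro x hx d
    simp [(Submodule.mem_bot _).mp hx]
  | succ k ih =>
    rw [initIdeal_succ f hk]
    exact (ih (by omega)).sup (isHomog_span_singleton (hdeg _))

/-- Sum of the first `i` degrees. -/
def initSum (a : Fin r → ℕ) (i : ℕ) : ℕ := ∑ j ∈ {j : Fin r | (j : ℕ) < i}, a j

lemma initSum_succ (a : Fin r → ℕ) {i : ℕ} (hi : i < r) :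
    initSum a (i + 1) = initSum a i + a ⟨i, hi⟩ := by
  have : ({j : Fin r | (j : ℕ) < i + 1} : Finset (Fin r)) =
      insert ⟨i, hi⟩ ({j : Fin r | (j : ℕ) < i} : Finset (Fin r)) := by
    ext j
    simp only [Finset.mem_filter_univ, Finset.mem_insert, Fin.ext_iff]
    omega
  rw [initSum, this, Finset.sum_insert (by simp), add_comm, initSum]

lemma initSum_zero (a : Fin r → ℕ) : initSum a 0 = 0 := by simp [initSum]

open KoszulIndex in
/-- Vanishing of the Koszul homology of linear forms on `A / (f_1, …, f_k)` in low degrees. -/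
lemma exists_koszulD_sub_mem {ℓ : ℕ → MvPolynomial (Fin n) K} {t : ℕ}
    (hℓ : ∀ j < t, (ℓ j).IsHomogeneous 1)
    (hℓreg : ∀ j < t, ∀ x, ℓ j * x ∈ Ideal.span (ℓ '' Set.Iio j) →
      x ∈ Ideal.span (ℓ '' Set.Iio j))
    {a : Fin r → ℕ} (hmono : Monotone a) {f : Fin r → MvPolynomial (Fin n) K}
    (hreg : IsRegSeq f) (hdeg : ∀ i, (f i).IsHomogeneous (a i)) {k : ℕ} (hk : k ≤ r) :
    ∀ {i e : ℕ} {ω : KoszulIndex t → MvPolynomial (Fin n) K}, 1 ≤ i → OnLevel i ω →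
      (∀ s, (ω s).IsHomogeneous e) → (∀ s, koszulD ℓ t ω s ∈ initIdeal f k) →
      (k < i ∨ e + i < initSum a i) →
      ∃ η, OnLevel (i + 1) η ∧ ∀ s, ω s - koszulD ℓ t η s ∈ initIdeal f k := by
  induction k with
  | zero =>
    intro i e ω hi hω _ hd _
    obtain ⟨i, rfl⟩ := Nat.exists_eq_add_of_le' hi
    rw [initIdeal_zero] at hd
    obtain ⟨η, hη, hηd⟩ := exists_koszulD_eq hℓreg hω
      (funext fun s => (Submodule.mem_bot _).mp (hd s))
    exact ⟨η, hη, fun s => by simp [hηd]⟩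
  | succ k ih =>
    intro i e ω hi hω hωe hd hb
    have hkr : k < r := hk
    have hF := isHomog_initIdeal hdeg hkr.le
    have hF' := isHomog_initIdeal hdeg hk
    have hle : initIdeal f k ≤ initIdeal f (k + 1) := by
      rw [initIdeal_succ f hkr]; exact le_sup_left
    have hfk : f ⟨k, hkr⟩ ∈ initIdeal f (k + 1) := by
      rw [initIdeal_succ f hkr]; exact Ideal.mem_sup_right (Ideal.mem_span_singleton_self _)
    have hb' : k < i ∨ e + i < initSum a i := hb.imp_left fun h => by omega
    have hde : ∀ s, (koszulD ℓ t ω s).IsHomogeneous (e + 1) := fun s => by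
      have := koszulD_homogeneousComponent hℓ ω e s
      simp_rw [homogeneousComponent_eq_self (hωe _)] at this
      rw [this]
      exact homogeneousComponent_isHomogeneous _ _
    obtain ⟨i, rfl⟩ := Nat.exists_eq_add_of_le' hi
    have key : ∀ s, ∃ y, koszulD ℓ t ω s - f ⟨k, hkr⟩ * y ∈ initIdeal f k ∧
        y.IsHomogeneous (e + 1 - a ⟨k, hkr⟩) ∧ (e + 1 < a ⟨k, hkr⟩ → y = 0) ∧
        (level s ≠ i → y = 0) := by
      intro s
      by_cases hs : level s = i
      · have h1 := hd s
        rw [initIdeal_succ f hkr] at h1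
        obtain ⟨x, hx, z, hz, h1⟩ := Submodule.mem_sup.mp h1
        obtain ⟨y, rfl⟩ := Ideal.mem_span_singleton'.mp hz
        have h2 := congrArg (homogeneousComponent (e + 1)) h1
        rw [homogeneousComponent_eq_self (hde s), map_add, mul_comm,
          homogeneousComponent_mul_of_isHomogeneous (hdeg _)] at h2
        have h3 := hF x hx (e + 1)
        split_ifs at h2 with hea
        · refine ⟨_, ?_, homogeneousComponent_isHomogeneous (e + 1 - a ⟨k, hkr⟩) y,
            fun h => absurd hea (by omega), fun h => absurd hs h⟩
          rw [← h2]
          simpa using h3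
        · refine ⟨0, ?_, isHomogeneous_zero _ _ _, fun _ => rfl, fun _ => rfl⟩
          rw [← h2]
          simpa using h3
      · refine ⟨0, ?_, isHomogeneous_zero _ _ _, fun _ => rfl, fun _ => rfl⟩
        rw [hω.koszulD s hs]
        simp
    choose η hη hηe hη0 hηl using key
    have hηL : OnLevel i η := fun s hs => hηl s hs
    by_cases hea : e + 1 < a ⟨k, hkr⟩
    · obtain ⟨ξ, hξ, hξd⟩ := ih hkr.le hi hω hωe
        (fun s => by simpa [hη0 s hea] using hη s) hb'
      exact ⟨ξ, hξ, fun s => hle (hξd s)⟩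
    · have hi1 : 1 ≤ i := by
        by_contra h0
        obtain rfl : i = 0 := by omega
        have h0r : 0 < r := by omega
        have := hmono (show (⟨0, h0r⟩ : Fin r) ≤ ⟨k, hkr⟩ from Nat.zero_le k)
        rw [initSum_succ a h0r, initSum_zero] at hb
        omega
      have hηd : ∀ s, koszulD ℓ t η s ∈ initIdeal f k := fun s => by
        refine hreg.mem_initIdeal hkr ?_
        have h1 := koszulD_mem_of_forall_mem (ℓ := ℓ) (ω := koszulD ℓ t ω - f ⟨k, hkr⟩ • η) hη s
        rw [map_sub, map_smul, koszulD_koszulD] at h1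
        simpa using h1
      have hbη : k < i ∨ (e + 1 - a ⟨k, hkr⟩) + i < initSum a i := by
        rcases hb with h | h
        · exact Or.inl (by omega)
        · by_cases hki : k < i
          · exact Or.inl hki
          · have hir : i < r := by omega
            have := hmono (show (⟨i, hir⟩ : Fin r) ≤ ⟨k, hkr⟩ from by
              simpa using hki)
            rw [initSum_succ a hir] at h
            exact Or.inr (by omega)
      obtain ⟨ξ, hξ, hξd⟩ := ih hkr.le hi1 hηL hηe hηd hbη
      set ζ : KoszulIndex t → MvPolynomial (Fin n) K :=
        fun s => homogeneousComponent e (f ⟨k, hkr⟩ * ξ s) with hζ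
      have hζF : ∀ s, ζ s ∈ initIdeal f (k + 1) := fun s =>
        hF' _ (Ideal.mul_mem_right _ _ hfk) e
      have hζd : ∀ s, koszulD ℓ t (ω - ζ) s ∈ initIdeal f k := fun s => by
        have h1 : koszulD ℓ t ζ s =
            homogeneousComponent (e + 1) (f ⟨k, hkr⟩ * koszulD ℓ t ξ s) := by
          have := koszulD_homogeneousComponent hℓ (f ⟨k, hkr⟩ • ξ) e s
          rw [map_smul] at this
          exact this
        have h2 : koszulD ℓ t ω s - f ⟨k, hkr⟩ * koszulD ℓ t ξ s ∈ initIdeal f k := by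
          have := Ideal.add_mem _ (hη s) (Ideal.mul_mem_left _ (f ⟨k, hkr⟩) (hξd s))
          convert this using 1
          ring
        have h3 := hF _ h2 (e + 1)
        rw [map_sub, homogeneousComponent_eq_self (hde s)] at h3
        rw [map_sub, Pi.sub_apply, h1]
        exact h3
      have hζL : OnLevel (i + 1) ζ := fun s hs => by simp [hζ, hξ s hs]
      obtain ⟨θ, hθ, hθd⟩ := ih hkr.le hi (ω := ω - ζ)
        (fun s hs => by simp [hω s hs, hζL s hs])
        (fun s => (hωe s).sub (homogeneousComponent_isHomogeneous _ _)) hζd hb'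
      refine ⟨θ, hθ, fun s => ?_⟩
      have := Ideal.add_mem _ (hle (hθd s)) (hζF s)
      convert this using 1
      simp only [Pi.sub_apply]
      ring

open KoszulIndex in
/-- A nonzero class modulo a homogeneous regular sequence annihilated by `t` independent linear
forms lives in large degree. -/
lemma initSum_le_of_forall_mul_mem {ℓ : ℕ → MvPolynomial (Fin n) K} {t : ℕ}
    (hℓ : ∀ j < t, (ℓ j).IsHomogeneous 1)
    (hℓreg : ∀ j < t, ∀ x, ℓ j * x ∈ Ideal.span (ℓ '' Set.Iio j) →
      x ∈ Ideal.span (ℓ '' Set.Iio j))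
    {a : Fin r → ℕ} (hmono : Monotone a) {f : Fin r → MvPolynomial (Fin n) K}
    (hreg : IsRegSeq f) (hdeg : ∀ i, (f i).IsHomogeneous (a i))
    {g : MvPolynomial (Fin n) K} {D : ℕ} (hg : g.IsHomogeneous D)
    (hgF : g ∉ Ideal.span (Set.range f))
    (hℓg : ∀ j < t, ℓ j * g ∈ Ideal.span (Set.range f)) :
    t ≤ r ∧ initSum a t ≤ D + t := by
  rcases Nat.eq_zero_or_pos t with rfl | ht
  · simp [initSum_zero]
  by_contra hb
  rw [← initIdeal_self] at hgF hℓg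
  have hω : OnLevel t (fun s : KoszulIndex t => if level s = t then g else 0) :=
    fun s hs => if_neg hs
  obtain ⟨η, hη, hηd⟩ := exists_koszulD_sub_mem hℓ hℓreg hmono hreg hdeg le_rfl ht hω
    (e := D) (fun s => by
      split_ifs
      · exact hg
      · exact isHomogeneous_zero _ _ _)
    (koszulD_mem fun j hj s => by
      split_ifs
      · exact hℓg j hj
      · simp)
    (by omega)
  obtain ⟨s, hs⟩ := exists_level_eq t
  have := hηd s
  rw [hη.eq_zero_of_lt (by omega), map_zero] at this
  simp [hs] at this
  exact hgF this

end Initial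

section LinearForms

variable {K σ : Type*} [Field K]

lemma mem_span_X_of_X_mul_mem {s : Set σ} {j : σ} (hj : j ∉ s) {x : MvPolynomial σ K}
    (hx : X j * x ∈ Ideal.span (X '' s : Set (MvPolynomial σ K))) :
    x ∈ Ideal.span (X '' s : Set (MvPolynomial σ K)) := by
  rw [mem_ideal_span_X_image] at hx ⊢
  intro m hm
  obtain ⟨i, hi, hne⟩ := hx (Finsupp.single j 1 + m) (by
    rwa [mem_support_iff, coeff_X_mul, ← mem_support_iff])
  refine ⟨i, hi, ?_⟩
  have hij : j ≠ i := fun h => hj (h ▸ hi)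
  simpa [Finsupp.single_apply, hij] using hne

/-- A space of linear forms admits a basis which is a regular sequence. -/
lemma exists_regular_linear_forms {n : ℕ} (W : Submodule K (MvPolynomial (Fin n) K))
    (hW : W ≤ homogeneousSubmodule (Fin n) K 1) :
    ∃ ℓ : ℕ → MvPolynomial (Fin n) K, (∀ j < Module.finrank K W, ℓ j ∈ W) ∧
      ∀ j < Module.finrank K W, ∀ x, ℓ j * x ∈ Ideal.span (ℓ '' Set.Iio j) →
        x ∈ Ideal.span (ℓ '' Set.Iio j) := by
  rw [homogeneousSubmodule_one_eq_span_X] at hW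
  have : Module.Finite K (Submodule.span K (Set.range (X : Fin n → MvPolynomial (Fin n) K))) :=
    Module.Finite.span_of_finite K (Set.finite_range _)
  have : Module.Finite K W := Submodule.finiteDimensional_of_le hW
  set t := Module.finrank K W
  let w : Module.Basis (Fin t) K W := Module.finBasis K W
  have hv : LinearIndependent K (Submodule.inclusion hW ∘ w) :=
    w.linearIndependent.map' _ (Submodule.ker_inclusion _ _ _)
  let b := Module.Basis.sumExtend hv
  let b₀ : Module.Basis (Fin n) K _ := Module.Basis.span (linearIndependent_X (Fin n) K)
  let e := (SymmetricAlgebra.equivMvPolynomial b).symm.trans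
    (SymmetricAlgebra.equivMvPolynomial b₀)
  have hb₀ : Module.Basis.constr b₀ K (X : Fin n → MvPolynomial (Fin n) K) =
      Submodule.subtype _ := by
    refine b₀.ext fun i => ?_
    rw [Module.Basis.constr_basis]
    exact (congrArg Subtype.val (Module.Basis.span_apply (linearIndependent_X (Fin n) K) i)).symm
  have he : ∀ i, e (X (Sum.inl i)) = w i := by
    intro i
    have hbi : b (Sum.inl i) = Submodule.inclusion hW (w i) := by
      simp [b, Module.Basis.sumExtend]
      rfl
    simp only [e, AlgEquiv.trans_apply, SymmetricAlgebra.equivMvPolynomial_symm_X]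
    rw [hbi]
    refine (SymmetricAlgebra.lift_ι_apply _ _).trans ?_
    rw [hb₀]
    rfl
  refine ⟨fun j => if h : j < t then (w ⟨j, h⟩ : MvPolynomial (Fin n) K) else 0,
    fun j hj => by simp [hj], fun j hj x hx => ?_⟩
  set ℓ : ℕ → MvPolynomial (Fin n) K :=
    fun j => if h : j < t then (w ⟨j, h⟩ : MvPolynomial (Fin n) K) else 0
  have hℓ : ∀ i : Fin t, ℓ i = e (X (Sum.inl i)) := fun i => by simp [ℓ, he]
  have hspan : Ideal.span (ℓ '' Set.Iio j) =
      Ideal.map e (Ideal.span (X '' (Sum.inl '' {i : Fin t | (i : ℕ) < j}))) := by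
    rw [Ideal.map_span, Set.image_image, Set.image_image]
    congr 1
    ext p
    constructor
    · rintro ⟨i, hi, rfl⟩
      exact ⟨⟨i, hi.trans hj⟩, hi, (hℓ ⟨i, hi.trans hj⟩).symm⟩
    · rintro ⟨i, hi, rfl⟩
      exact ⟨i, hi, hℓ i⟩
  rw [hspan, Ideal.mem_map_of_equiv] at hx ⊢
  obtain ⟨y, hy, hyx⟩ := hx
  refine ⟨e.symm x, mem_span_X_of_X_mul_mem (j := Sum.inl ⟨j, hj⟩) (by simp) ?_,
    e.apply_symm_apply x⟩
  convert hy
  apply e.injective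
  rw [hyx, map_mul, e.apply_symm_apply, ← hℓ ⟨j, hj⟩]

end LinearForms

section HilbertFunction

lemma finrank_map_add_finrank_inf_ker {K V W : Type*} [Field K] [AddCommGroup V] [Module K V]
    [AddCommGroup W] [Module K W] (φ : V →ₗ[K] W) (U : Submodule K V) [FiniteDimensional K U] :
    Module.finrank K (U.map φ) + Module.finrank K ↥(U ⊓ LinearMap.ker φ) =
      Module.finrank K U := by
  rw [← LinearMap.finrank_range_add_finrank_ker (φ.domRestrict U), LinearMap.range_domRestrict,
    LinearMap.ker_domRestrict, ← Submodule.finrank_map_subtype_eq U, Submodule.map_comap_subtype]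

variable {K : Type*} [Field K] {n r : ℕ}

lemma finiteDimensional_homogeneousSubmodule (d : ℕ) :
    FiniteDimensional K (homogeneousSubmodule (Fin n) K d) :=
  Module.Finite.iff_fg.mpr (homogeneousSubmodule_fg _ _ d)

lemma finiteDimensional_component (I : Ideal (MvPolynomial (Fin n) K)) (d : ℕ) :
    FiniteDimensional K (component I d) :=
  have := finiteDimensional_homogeneousSubmodule (K := K) (n := n) d
  Submodule.finiteDimensional_of_le inf_le_right

/-- The degree-`e` component of the colon ideal `Q : h`. -/
noncomputable def colonComponent (Q : Ideal (MvPolynomial (Fin n) K)) (h : MvPolynomial (Fin n) K)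
    (e : ℕ) : Submodule K (MvPolynomial (Fin n) K) :=
  homogeneousSubmodule (Fin n) K e ⊓
    (Submodule.restrictScalars K Q).comap (LinearMap.mulLeft K h)

lemma mem_colonComponent {Q : Ideal (MvPolynomial (Fin n) K)} {h x : MvPolynomial (Fin n) K}
    {e : ℕ} : x ∈ colonComponent Q h e ↔ x.IsHomogeneous e ∧ h * x ∈ Q := Iff.rfl

lemma hilb_sup_span_singleton {Q : Ideal (MvPolynomial (Fin n) K)} (hQ : IsHomog Q)
    {h : MvPolynomial (Fin n) K} {a : ℕ} (hh : h.IsHomogeneous a) (e : ℕ) :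
    hilb (Q ⊔ Ideal.span {h}) (a + e) + Module.finrank K (colonComponent Q h e) =
      hilb Q (a + e) + Module.finrank K (homogeneousSubmodule (Fin n) K e) := by
  have := finiteDimensional_homogeneousSubmodule (K := K) (n := n) e
  have := finiteDimensional_component (Q ⊔ Ideal.span {h}) (a + e)
  set π := (Submodule.restrictScalars K Q).mkQ
  have h1 := finrank_map_add_finrank_inf_ker π (component (Q ⊔ Ideal.span {h}) (a + e))
  have h2 := finrank_map_add_finrank_inf_ker (π ∘ₗ LinearMap.mulLeft K h)
    (homogeneousSubmodule (Fin n) K e)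
  have hk1 : component (Q ⊔ Ideal.span {h}) (a + e) ⊓ LinearMap.ker π = component Q (a + e) := by
    rw [Submodule.ker_mkQ]
    ext x
    exact ⟨fun hx => ⟨hx.2, hx.1.2⟩, fun hx => ⟨⟨Ideal.mem_sup_left hx.1, hx.2⟩, hx.1⟩⟩
  have hk2 : homogeneousSubmodule (Fin n) K e ⊓ LinearMap.ker (π ∘ₗ LinearMap.mulLeft K h) =
      colonComponent Q h e := by
    rw [LinearMap.ker_comp, Submodule.ker_mkQ, colonComponent]
  have hr : (component (Q ⊔ Ideal.span {h}) (a + e)).map π =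
      (homogeneousSubmodule (Fin n) K e).map (π ∘ₗ LinearMap.mulLeft K h) := by
    apply le_antisymm
    · rintro _ ⟨x, ⟨hx, hxd⟩, rfl⟩
      obtain ⟨q, hq, z, hz, rfl⟩ := Submodule.mem_sup.mp hx
      obtain ⟨y, rfl⟩ := Ideal.mem_span_singleton'.mp hz
      refine ⟨homogeneousComponent e y, homogeneousComponent_mem _ _, ?_⟩
      have h3 := homogeneousComponent_eq_self hxd
      rw [map_add, mul_comm y, homogeneousComponent_mul_of_isHomogeneous hh,
        if_pos (Nat.le_add_right a e), Nat.add_sub_cancel_left] at h3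
      have hπ : π (homogeneousComponent (a + e) q) = 0 :=
        (Submodule.Quotient.mk_eq_zero _).mpr (hQ q hq (a + e))
      rw [mul_comm y, ← h3, map_add, hπ, zero_add]
      rfl
    · rintro _ ⟨x, hx, rfl⟩
      exact ⟨h * x, ⟨Ideal.mem_sup_right
        (Ideal.mul_mem_right _ _ (Ideal.mem_span_singleton_self h)), hh.mul hx⟩, rfl⟩
  rw [hk1, hr] at h1
  rw [hk2] at h2
  rw [hilb, hilb]
  omega

lemma hilb_sup_span_singleton_of_lt {Q : Ideal (MvPolynomial (Fin n) K)} (hQ : IsHomog Q)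
    {h : MvPolynomial (Fin n) K} {a : ℕ} (hh : h.IsHomogeneous a) {d : ℕ} (hd : d < a) :
    hilb (Q ⊔ Ideal.span {h}) d = hilb Q d := by
  have : component (Q ⊔ Ideal.span {h}) d = component Q d := by
    apply le_antisymm
    · rintro x ⟨hx, hxd⟩
      obtain ⟨q, hq, z, hz, rfl⟩ := Submodule.mem_sup.mp hx
      obtain ⟨y, rfl⟩ := Ideal.mem_span_singleton'.mp hz
      refine ⟨?_, hxd⟩
      have h3 := homogeneousComponent_eq_self hxd
      rw [map_add, mul_comm y, homogeneousComponent_mul_of_isHomogeneous hh,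
        if_neg (by omega), add_zero] at h3
      rw [mul_comm y, ← h3]
      exact hQ q hq d
    · exact inf_le_inf_right _ fun x hx => Ideal.mem_sup_left hx
  rw [hilb, hilb, this]

lemma colonComponent_initIdeal {f : Fin r → MvPolynomial (Fin n) K} (hf : IsRegSeq f) {k : ℕ}
    (hk : k < r) (e : ℕ) :
    colonComponent (initIdeal f k) (f ⟨k, hk⟩) e = component (initIdeal f k) e := by
  ext x
  exact ⟨fun hx => ⟨hf.mem_initIdeal hk hx.2, hx.1⟩, fun hx => ⟨hx.2, Ideal.mul_mem_left _ _ hx.1⟩⟩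

/-- The Hilbert function of a complete intersection depends only on the degrees. -/
lemma hilb_initIdeal_congr {a : Fin r → ℕ} {f f' : Fin r → MvPolynomial (Fin n) K}
    (hf : IsRegSeq f) (hfd : ∀ i, (f i).IsHomogeneous (a i))
    (hf' : IsRegSeq f') (hfd' : ∀ i, (f' i).IsHomogeneous (a i)) {k : ℕ} (hk : k ≤ r) (d : ℕ) :
    hilb (initIdeal f k) d = hilb (initIdeal f' k) d := by
  induction k generalizing d with
  | zero => rw [initIdeal_zero, initIdeal_zero]
  | succ k ih =>
    have hkr : k < r := hk
    rw [initIdeal_succ f hkr, initIdeal_succ f' hkr]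
    have hF := isHomog_initIdeal hfd hkr.le
    have hF' := isHomog_initIdeal hfd' hkr.le
    by_cases hd : d < a ⟨k, hkr⟩
    · rw [hilb_sup_span_singleton_of_lt hF (hfd _) hd,
        hilb_sup_span_singleton_of_lt hF' (hfd' _) hd, ih hkr.le]
    · obtain ⟨e, rfl⟩ := Nat.exists_eq_add_of_le (not_lt.mp hd)
      have h1 := hilb_sup_span_singleton hF (hfd ⟨k, hkr⟩) e
      have h2 := hilb_sup_span_singleton hF' (hfd' ⟨k, hkr⟩) e
      rw [colonComponent_initIdeal hf] at h1
      rw [colonComponent_initIdeal hf'] at h2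
      have h3 := ih hkr.le e
      rw [ih hkr.le] at h1
      rw [hilb] at h3
      rw [hilb] at h3
      omega

/-- A linear annihilator of a nonzero class modulo a complete intersection is small. -/
lemma finrank_colonComponent_one_le {a : Fin r → ℕ} (hmono : Monotone a)
    {f : Fin r → MvPolynomial (Fin n) K}
    (hreg : IsRegSeq f) (hdeg : ∀ i, (f i).IsHomogeneous (a i))
    {g : MvPolynomial (Fin n) K} {D : ℕ} (hg : g.IsHomogeneous D)
    (hgF : g ∉ Ideal.span (Set.range f)) :
    Module.finrank K (colonComponent (Ideal.span (Set.range f)) g 1) ≤ r ∧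
      initSum a (Module.finrank K (colonComponent (Ideal.span (Set.range f)) g 1)) ≤
        D + Module.finrank K (colonComponent (Ideal.span (Set.range f)) g 1) := by
  obtain ⟨ℓ, hℓ, hℓreg⟩ := exists_regular_linear_forms
    (colonComponent (Ideal.span (Set.range f)) g 1) inf_le_left
  exact initSum_le_of_forall_mul_mem (fun j hj => (hℓ j hj).1) hℓreg hmono hreg hdeg hg hgF
    fun j hj => by rw [mul_comm]; exact (hℓ j hj).2

lemma colonComponent_zero {Q : Ideal (MvPolynomial (Fin n) K)} {h : MvPolynomial (Fin n) K}
    (hh : h ∉ Q) : colonComponent Q h 0 = ⊥ := by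
  rw [eq_bot_iff]
  rintro x ⟨hx, hxQ⟩
  rw [homogeneousSubmodule_zero] at hx
  obtain ⟨c, rfl⟩ := Submodule.mem_one.mp hx
  rw [Submodule.mem_bot]
  by_contra hc
  have hc0 : c ≠ 0 := fun h => hc (by rw [h, map_zero])
  refine hh ?_
  have := Q.mul_mem_left (C c⁻¹) (show h * C c ∈ Q from hxQ)
  rwa [mul_left_comm, ← C_mul, inv_mul_cancel₀ hc0, C_1, mul_one] at this

end HilbertFunction

section Lex

variable {n r : ℕ}

lemma lexLe_iff {m m' : Fin n →₀ ℕ} : lexLe m m' ↔ toLex m ≤ toLex m' := by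
  rw [le_iff_eq_or_lt]
  rfl

lemma lexLe_trans {u v w : Fin n →₀ ℕ} (h : lexLe u v) (h' : lexLe v w) : lexLe u w := by
  rw [lexLe_iff] at *
  exact h.trans h'

lemma expDeg_add (u v : Fin n →₀ ℕ) : expDeg (u + v) = expDeg u + expDeg v := by
  simp [expDeg, Finset.sum_add_distrib]

lemma expDeg_single (i : Fin n) (k : ℕ) : expDeg (Finsupp.single i k) = k := by
  simp [expDeg, Finsupp.single_apply]

lemma expDeg_mono {u v : Fin n →₀ ℕ} (h : u ≤ v) : expDeg u ≤ expDeg v :=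
  Finset.sum_le_sum fun i _ => h i

lemma degree_eq_expDeg (u : Fin n →₀ ℕ) : u.degree = expDeg u :=
  Finset.sum_subset (Finset.subset_univ _) fun _ _ hi => Finsupp.notMem_support_iff.mp hi

lemma eq_of_le_of_expDeg_le {u v : Fin n →₀ ℕ} (h : u ≤ v) (h' : expDeg v ≤ expDeg u) :
    u = v := by
  have := (Finset.sum_eq_sum_iff_of_le fun i _ => h i).mp (h'.antisymm' (expDeg_mono h))
  exact Finsupp.ext fun i => this i (Finset.mem_univ i)

/-- Among the monomials of degree `d` divisible by `m`, the lex-smallest is `m` times a power of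
the last variable. -/
lemma lexLe_add_single_of_le {l : Fin n} (hl : ∀ j, j ≤ l) {m u : Fin n →₀ ℕ} (h : m ≤ u) :
    lexLe (m + Finsupp.single l (expDeg u - expDeg m)) u := by
  rcases lt_trichotomy (toLex u) (toLex (m + Finsupp.single l (expDeg u - expDeg m)))
    with hlt | heq | hgt
  · exfalso
    obtain ⟨i, hi, hi'⟩ := hlt
    change ∀ j < i, u j = (m + Finsupp.single l (expDeg u - expDeg m)) j at hi
    change u i < (m + Finsupp.single l (expDeg u - expDeg m)) i at hi'
    have hil : i = l := by
      by_contra hne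
      have := h i
      simp only [Finsupp.add_apply, Finsupp.single_eq_of_ne hne] at hi'
      omega
    have hle : u ≤ m + Finsupp.single l (expDeg u - expDeg m) := by
      intro j
      rcases (hl j).lt_or_eq with hj | rfl
      · exact (hi j (hil ▸ hj)).le
      · exact (hil ▸ hi').le
    have := eq_of_le_of_expDeg_le hle (by
      rw [expDeg_add, expDeg_single]
      have := expDeg_mono h
      omega)
    rw [← this] at hi'
    exact hi'.false
  · exact Or.inl (toLex.injective heq).symm
  · exact Or.inr hgt

/-- `m` is the lex-largest exponent vector of its degree outside of the pure-powers ideal: it is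
obtained by filling up the exponents greedily. -/
def IsGreedy (hrn : r ≤ n) (a : Fin r → ℕ) (m : Fin n →₀ ℕ) : Prop :=
  (∀ i, m (Fin.castLE hrn i) < a i) ∧ ∃ p : Fin n,
    (∀ j < p, (∀ i, Fin.castLE hrn i = j → a i = m j + 1) ∧ (r ≤ j → m j = expDeg m)) ∧
    ∀ j, p < j → m j = 0

lemma exists_greedy {α : Fin n → ℕ} (hn : 0 < n) {D : ℕ} (hD : D ≤ ∑ j, α j) :
    ∃ m : Fin n →₀ ℕ, (∀ j, m j ≤ α j) ∧ expDeg m = D ∧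
      ∃ p : Fin n, (∀ j < p, m j = α j) ∧ ∀ j, p < j → m j = 0 := by
  induction D with
  | zero => exact ⟨0, fun j => Nat.zero_le _, by simp [expDeg], ⟨0, hn⟩,
      fun j hj => absurd hj (Nat.not_lt_zero _), fun j _ => rfl⟩
  | succ D ih =>
    obtain ⟨m, hm, hdeg, p, hp, hp'⟩ := ih (by omega)
    have hex : {j | m j < α j}.Nonempty := by
      by_contra hne
      have : ∑ j, α j ≤ expDeg m := Finset.sum_le_sum fun j _ =>
        not_lt.mp fun h => hne ⟨j, h⟩
      omega
    obtain ⟨q, hq, hqmin⟩ := WellFounded.has_min wellFounded_lt _ hex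
    have hpq : p ≤ q := not_lt.mp fun h => hq.ne (hp q h)
    refine ⟨m + Finsupp.single q 1, fun j => ?_, ?_, q, fun j hj => ?_, fun j hj => ?_⟩
    · by_cases hjq : j = q
      · subst hjq
        simpa using hq
      · simpa [Finsupp.single_eq_of_ne hjq] using hm j
    · rw [expDeg_add, expDeg_single, hdeg]
    · have := not_lt.mp fun h : m j < α j => hqmin j h hj
      simpa [Finsupp.single_eq_of_ne hj.ne] using (hm j).antisymm this
    · simpa [Finsupp.single_eq_of_ne hj.ne'] using hp' j (hpq.trans_lt hj)

lemma exists_isGreedy (hrn : r ≤ n) (hn : 0 < n) {a : Fin r → ℕ} {u : Fin n →₀ ℕ}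
    (hu : ∀ i, u (Fin.castLE hrn i) < a i) : ∃ m, IsGreedy hrn a m ∧ expDeg m = expDeg u := by
  let α : Fin n → ℕ := fun j => if h : (j : ℕ) < r then a ⟨j, h⟩ - 1 else expDeg u
  have hα : ∀ i, α (Fin.castLE hrn i) = a i - 1 := fun i => by simp [α]
  have huα : ∀ j, u j ≤ α j := by
    intro j
    by_cases hj : (j : ℕ) < r
    · have := hu ⟨j, hj⟩
      rw [show Fin.castLE hrn ⟨j, hj⟩ = j from rfl] at this
      simp only [α, dif_pos hj]
      omega
    · simp only [α, dif_neg hj]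
      exact Finset.single_le_sum (f := u) (fun i _ => Nat.zero_le _) (Finset.mem_univ j)
  obtain ⟨m, hm, hdeg, p, hp, hp'⟩ := exists_greedy hn
    (show expDeg u ≤ ∑ j, α j from Finset.sum_le_sum fun j _ => huα j)
  refine ⟨m, ⟨fun i => ?_, p, fun j hj => ⟨?_, fun hrj => ?_⟩, hp'⟩, hdeg⟩
  · have := hm (Fin.castLE hrn i)
    rw [hα] at this
    have := hu i
    omega
  · rintro i rfl
    rw [hp _ hj, hα]
    have := hu i
    omega
  · rw [hp _ hj, hdeg]
    exact dif_neg (not_lt.mpr hrj)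

lemma IsGreedy.le_of_lexLe {hrn : r ≤ n} {a : Fin r → ℕ} {m : Fin n →₀ ℕ} (hm : IsGreedy hrn a m)
    {l : Fin n} {k : ℕ} {u : Fin n →₀ ℕ}
    (hu : ∀ i, u (Fin.castLE hrn i) < a i) (h : lexLe (m + Finsupp.single l k) u) : m ≤ u := by
  rcases h with rfl | ⟨i, hi, hi'⟩
  · exact le_self_add
  obtain ⟨-, p, hp, hp'⟩ := hm
  have hmi : m i < u i := by
    rw [Finsupp.add_apply] at hi'
    omega
  intro j
  rcases lt_trichotomy j i with hj | rfl | hj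
  · have := hi j hj
    rw [Finsupp.add_apply] at this
    omega
  · exact hmi.le
  · have : m j = 0 := by
      by_cases hip : i < p
      · by_cases hir : (i : ℕ) < r
        · have h1 := (hp i hip).1 ⟨i, hir⟩ rfl
          have h2 := hu ⟨i, hir⟩
          rw [show Fin.castLE hrn ⟨i, hir⟩ = i from rfl] at h2
          omega
        · have h1 := (hp i hip).2 (not_lt.mp hir)
          have h2 : m i + m j ≤ expDeg m := by
            rw [← Finset.sum_pair hj.ne]
            exact Finset.sum_le_sum_of_subset (Finset.subset_univ _)
          omega
      · exact hp' j ((not_lt.mp hip).trans_lt hj)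
    omega

/-- If the degree of a greedy vector is at least `a_1 + ⋯ + a_t - t`, then at least `t` of its
exponents are maximal. -/
lemma IsGreedy.le_card {hrn : r ≤ n} {a : Fin r → ℕ} {m : Fin n →₀ ℕ} (hm : IsGreedy hrn a m)
    {t : ℕ} (htr : t ≤ r) (ht : initSum a t ≤ expDeg m + t) :
    t ≤ Finset.card {i : Fin r | a i = m (Fin.castLE hrn i) + 1} := by
  by_contra hlt
  set T : Finset (Fin r) := {j : Fin r | (j : ℕ) < t}
  have hT : T.card = t := by
    rw [Fin.card_filter_val_lt, min_eq_right htr]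
  have hex : ∃ i ∈ T, a i ≠ m (Fin.castLE hrn i) + 1 := by
    by_contra hall
    push Not at hall
    have : T ⊆ ({i : Fin r | a i = m (Fin.castLE hrn i) + 1} : Finset (Fin r)) := fun i hi => by
      simpa using hall i hi
    have := Finset.card_le_card this
    omega
  obtain ⟨i, hi, hne⟩ := hex
  obtain ⟨hma, p, hp, hp'⟩ := hm
  have hpi : p ≤ Fin.castLE hrn i := not_lt.mp fun h => hne ((hp _ h).1 i rfl)
  have hit : (i : ℕ) < t := by simpa [T] using hi
  have hsum : expDeg m = ∑ j ∈ T, m (Fin.castLE hrn j) := by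
    refine .trans ?_ (Finset.sum_map T (Fin.castLEEmb hrn) m)
    refine (Finset.sum_subset (Finset.subset_univ _) fun j _ hj => ?_).symm
    refine hp' j (hpi.trans_lt ?_)
    by_contra hji
    have hji' : (j : ℕ) ≤ i := not_lt.mp hji
    refine hj (Finset.mem_map.mpr ⟨⟨j, by omega⟩, ?_, rfl⟩)
    simp only [T, Finset.mem_filter_univ]
    omega
  have hlt' : ∑ j ∈ T, (m (Fin.castLE hrn j) + 1) < ∑ j ∈ T, a j :=
    Finset.sum_lt_sum (fun j _ => hma j) ⟨i, hi, lt_of_le_of_ne (hma i) hne.symm⟩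
  rw [Finset.sum_add_distrib, ← hsum, Finset.sum_const, hT, smul_eq_mul, mul_one] at hlt'
  exact absurd ht (not_le.mpr hlt')

end Lex

section PurePowers

variable {K : Type*} [Field K] {n r : ℕ}

lemma mem_span_powers {hrn : r ≤ n} {a : Fin r → ℕ} (q : Fin r → Prop)
    {x : MvPolynomial (Fin n) K} :
    x ∈ Ideal.span {p : MvPolynomial (Fin n) K | ∃ j, q j ∧ p = X (Fin.castLE hrn j) ^ a j} ↔
      ∀ u ∈ x.support, ∃ j, q j ∧ a j ≤ u (Fin.castLE hrn j) := by
  have : {p : MvPolynomial (Fin n) K | ∃ j, q j ∧ p = X (Fin.castLE hrn j) ^ a j} =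
      (fun s => monomial s (1 : K)) ''
        {s | ∃ j, q j ∧ s = Finsupp.single (Fin.castLE hrn j) (a j)} := by
    ext p
    constructor
    · rintro ⟨j, hj, rfl⟩
      exact ⟨_, ⟨j, hj, rfl⟩, X_pow_eq_monomial.symm⟩
    · rintro ⟨_, ⟨j, hj, rfl⟩, rfl⟩
      exact ⟨j, hj, X_pow_eq_monomial.symm⟩
  rw [this, mem_ideal_span_monomial_image]
  refine forall₂_congr fun u _ => ?_
  constructor
  · rintro ⟨_, ⟨j, hj, rfl⟩, hle⟩
    exact ⟨j, hj, Finsupp.single_le_iff.mp hle⟩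
  · rintro ⟨j, hj, hle⟩
    exact ⟨_, ⟨j, hj, rfl⟩, Finsupp.single_le_iff.mpr hle⟩

lemma mem_purePowers {hrn : r ≤ n} {a : Fin r → ℕ} {x : MvPolynomial (Fin n) K} :
    x ∈ purePowers K hrn a ↔ ∀ u ∈ x.support, ∃ j, a j ≤ u (Fin.castLE hrn j) := by
  have := mem_span_powers (hrn := hrn) (a := a) (fun _ => True) (x := x)
  simp only [true_and] at this
  rw [← this, purePowers]
  simp only [Set.range, eq_comm]

lemma isRegSeq_powers (hrn : r ≤ n) (a : Fin r → ℕ) :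
    IsRegSeq fun i : Fin r => (X (Fin.castLE hrn i) ^ a i : MvPolynomial (Fin n) K) := by
  intro i g hg
  rw [mem_span_powers (· < i)] at hg ⊢
  intro u hu
  dsimp only at hg
  obtain ⟨j, hj, hle⟩ := hg (Finsupp.single (Fin.castLE hrn i) (a i) + u) (by
    rwa [mul_comm, X_pow_eq_monomial, mem_support_iff, coeff_monomial_mul, one_mul,
      ← mem_support_iff])
  refine ⟨j, hj, ?_⟩
  have hne : Fin.castLE hrn j ≠ Fin.castLE hrn i := fun h => hj.ne (Fin.castLE_injective hrn h)
  simpa [Finsupp.single_eq_of_ne hne] using hle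

lemma monomial_mem_purePowers {hrn : r ≤ n} {a : Fin r → ℕ} {u : Fin n →₀ ℕ} :
    monomial u (1 : K) ∈ purePowers K hrn a ↔ ∃ j, a j ≤ u (Fin.castLE hrn j) := by
  classical
  rw [mem_purePowers, support_monomial, if_neg one_ne_zero]
  simp

lemma mem_purePowers_sup_span_monomial {hrn : r ≤ n} {a : Fin r → ℕ} {m : Fin n →₀ ℕ}
    {x : MvPolynomial (Fin n) K} :
    x ∈ purePowers K hrn a ⊔ Ideal.span {monomial m 1} ↔
      ∀ u ∈ x.support, (∃ j, a j ≤ u (Fin.castLE hrn j)) ∨ m ≤ u := by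
  have : purePowers K hrn a ⊔ Ideal.span {monomial m 1} =
      Ideal.span ((fun s => monomial s (1 : K)) ''
        (Set.range (fun j => Finsupp.single (Fin.castLE hrn j) (a j)) ∪ {m})) := by
    rw [Set.image_union, Set.image_singleton, ← Set.range_comp, Ideal.span_union, purePowers]
    simp only [X_pow_eq_monomial, Function.comp_def]
  rw [this, mem_ideal_span_monomial_image]
  simp [or_comm]

/-- A greedy monomial generates a lex-segment modulo the pure powers. -/
lemma isLPP_purePowers_sup_span {hrn : r ≤ n} {a : Fin r → ℕ} {m : Fin n →₀ ℕ}
    (hP : IsHomog (purePowers K hrn a)) (hm : IsGreedy hrn a m) (hn : 0 < n) :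
    IsLPP hrn a (purePowers K hrn a ⊔ Ideal.span {monomial m (1 : K)}) := by
  refine ⟨hP.sup (isHomog_span_singleton (isHomogeneous_monomial 1 rfl)), fun d => ?_⟩
  obtain ⟨l, hl⟩ : ∃ l : Fin n, ∀ j, j ≤ l :=
    ⟨⟨n - 1, by omega⟩, fun j => Fin.le_def.mpr (by change (j : ℕ) ≤ n - 1; omega)⟩
  refine ⟨{u | expDeg u = d ∧ expDeg m ≤ d ∧
    lexLe (m + Finsupp.single l (d - expDeg m)) u}, ⟨fun u hu => hu.1, fun u hu u' hd hle =>
      ⟨hd, hu.2.1, lexLe_trans hu.2.2 hle⟩⟩, ?_⟩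
  apply le_antisymm
  · rintro x ⟨hx, hxd⟩
    replace hx := mem_purePowers_sup_span_monomial.mp hx
    rw [← support_sum_monomial_coeff x]
    refine Submodule.sum_mem _ fun u hu => ?_
    have hud : u.degree = d := by
      by_contra h
      exact mem_support_iff.mp hu (hxd.coeff_eq_zero h)
    rcases hx u hu with h | h
    · refine Submodule.mem_sup_right ⟨?_, isHomogeneous_monomial _ hud⟩
      refine mem_purePowers.mpr fun v hv => ?_
      rw [Finset.mem_singleton.mp (support_monomial_subset hv)]
      exact h
    · refine Submodule.mem_sup_left ?_
      rw [← mul_one (coeff u x), ← smul_eq_mul, ← smul_monomial]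
      refine Submodule.smul_mem _ _ (Submodule.subset_span ⟨u, ?_, rfl⟩)
      rw [degree_eq_expDeg] at hud
      subst hud
      exact ⟨rfl, expDeg_mono h, lexLe_add_single_of_le hl h⟩
  · refine sup_le (Submodule.span_le.mpr ?_) (inf_le_inf_right _ fun x hx => Ideal.mem_sup_left hx)
    rintro _ ⟨u, ⟨hud, -, hlex⟩, rfl⟩
    refine ⟨mem_purePowers_sup_span_monomial.mpr fun v hv => ?_,
      isHomogeneous_monomial _ ((degree_eq_expDeg u).trans hud)⟩
    rw [Finset.mem_singleton.mp (support_monomial_subset hv)]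
    by_cases hu : ∃ j, a j ≤ u (Fin.castLE hrn j)
    · exact Or.inl hu
    · push Not at hu
      exact Or.inr (hm.le_of_lexLe hu hlex)

lemma card_le_finrank_colonComponent {hrn : r ≤ n} {a : Fin r → ℕ} (m : Fin n →₀ ℕ) :
    Finset.card {i : Fin r | a i = m (Fin.castLE hrn i) + 1} ≤
      Module.finrank K (colonComponent (purePowers K hrn a) (monomial m 1) 1) := by
  have := finiteDimensional_homogeneousSubmodule (K := K) (n := n) 1
  have : FiniteDimensional K (colonComponent (purePowers K hrn a) (monomial m (1 : K)) 1) :=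
    Submodule.finiteDimensional_of_le inf_le_left
  let v : {i : Fin r // i ∈ ({i : Fin r | a i = m (Fin.castLE hrn i) + 1} : Finset (Fin r))} →
    MvPolynomial (Fin n) K := fun i => X (Fin.castLE hrn i)
  have hv : LinearIndependent K v := (linearIndependent_X (Fin n) K).comp _
    ((Fin.castLE_injective hrn).comp Subtype.val_injective)
  rw [← Fintype.card_coe, ← finrank_span_eq_card hv]
  refine Submodule.finrank_mono (Submodule.span_le.mpr ?_)
  rintro _ ⟨⟨i, hi⟩, rfl⟩
  refine mem_colonComponent.mpr ⟨isHomogeneous_X _ _, ?_⟩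
  rw [← pow_one (v _), ← monomial_add_single, monomial_mem_purePowers]
  refine ⟨i, ?_⟩
  rw [Finset.mem_filter_univ] at hi
  simp [hi]

/-- If an ideal with the same Hilbert function as the pure powers misses a form of degree `D`,
then the pure powers miss a monomial of degree `D`. -/
lemma exists_expDeg_eq {hrn : r ≤ n} {a : Fin r → ℕ} {F : Ideal (MvPolynomial (Fin n) K)} {D : ℕ}
    (hF : hilb (purePowers K hrn a) D = hilb F D) {g : MvPolynomial (Fin n) K}
    (hg : g.IsHomogeneous D) (hgF : g ∉ F) :
    ∃ u : Fin n →₀ ℕ, (∀ i, u (Fin.castLE hrn i) < a i) ∧ expDeg u = D := by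
  by_contra hne
  push Not at hne
  have := finiteDimensional_homogeneousSubmodule (K := K) (n := n) D
  have hPD : component (purePowers K hrn a) D = homogeneousSubmodule (Fin n) K D := by
    refine le_antisymm inf_le_right fun x hx => ⟨mem_purePowers.mpr fun u hu => ?_, hx⟩
    by_contra h
    push Not at h
    refine mem_support_iff.mp hu (IsHomogeneous.coeff_eq_zero hx ?_)
    rw [degree_eq_expDeg]
    exact hne u h
  rw [hilb, hilb, hPD] at hF
  have hFD : component F D = homogeneousSubmodule (Fin n) K D :=
    Submodule.eq_of_le_of_finrank_eq inf_le_right hF.symm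
  have : g ∈ component F D := hFD ▸ hg
  exact hgF this.1

end PurePowers

/-- **Francisco.** Let `F ⊆ A = K[x_1,…,x_n]` be generated by a homogeneous regular
sequence of degree `a = (a_1,…,a_r)` and let `g ∉ F` be homogeneous of degree `D ≥ a_1`.
Then the almost complete intersection `I = F + (g)` satisfies `EGH_a(D)`. -/
theorem francisco {K : Type*} [Field K] {n r : ℕ} (hrn : r ≤ n) (hr : 0 < r)
    (a : Fin r → ℕ) (hpos : ∀ i, 0 < a i) (hmono : Monotone a)
    (f : Fin r → MvPolynomial (Fin n) K)
    (hreg : IsRegSeq f) (hdeg : ∀ i, (f i).IsHomogeneous (a i))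
    (g : MvPolynomial (Fin n) K) (D : ℕ) (hg : g.IsHomogeneous D)
    (hgF : g ∉ Ideal.span (Set.range f)) (hD : a ⟨0, hr⟩ ≤ D) :
    EGHd hrn a (Ideal.span (Set.range f) ⊔ Ideal.span {g}) D := by
  have hn : 0 < n := hr.trans_le hrn
  have hPdeg : ∀ i, (X (Fin.castLE hrn i) ^ a i : MvPolynomial (Fin n) K).IsHomogeneous (a i) :=
    fun i => isHomogeneous_X_pow _ _
  have hP : IsHomog (purePowers K hrn a) := by
    rw [purePowers, ← initIdeal_self]
    exact isHomog_initIdeal hPdeg le_rfl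
  have hF : IsHomog (Ideal.span (Set.range f)) := by
    rw [← initIdeal_self]
    exact isHomog_initIdeal hdeg le_rfl
  have hPF : ∀ d, hilb (purePowers K hrn a) d = hilb (Ideal.span (Set.range f)) d := fun d => by
    rw [purePowers, ← initIdeal_self, ← initIdeal_self f]
    exact hilb_initIdeal_congr (isRegSeq_powers hrn a) hPdeg hreg hdeg le_rfl d
  obtain ⟨u, hu, huD⟩ := exists_expDeg_eq (hPF D) hg hgF
  obtain ⟨m, hm, hmu⟩ := exists_isGreedy hrn hn hu
  have hmD : expDeg m = D := hmu.trans huD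
  have hmh : (monomial m (1 : K)).IsHomogeneous D :=
    isHomogeneous_monomial _ ((degree_eq_expDeg m).trans hmD)
  have hmP : monomial m (1 : K) ∉ purePowers K hrn a := fun h => by
    obtain ⟨j, hj⟩ := monomial_mem_purePowers.mp h
    exact hj.not_gt (hm.1 j)
  refine ⟨purePowers K hrn a ⊔ Ideal.span {monomial m 1}, isLPP_purePowers_sup_span hP hm hn,
    ?_, ?_⟩
  · have h1 := hilb_sup_span_singleton hP hmh 0
    have h2 := hilb_sup_span_singleton hF hg 0
    rw [colonComponent_zero hmP, finrank_bot, add_zero, add_zero] at h1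
    rw [colonComponent_zero hgF, finrank_bot, add_zero, add_zero] at h2
    rw [h1, h2, hPF]
  · have h1 := hilb_sup_span_singleton hP hmh 1
    have h2 := hilb_sup_span_singleton hF hg 1
    obtain ⟨htr, ht⟩ := finrank_colonComponent_one_le hmono hreg hdeg hg hgF
    rw [← hmD] at ht
    have h3 := (hm.le_card htr ht).trans (card_le_finrank_colonComponent (K := K) m)
    rw [hPF] at h1
    omega
end

section
/- (Abedelfatah) Let f ⊆ A = K[x_1,…,x_n] be an ideal generated by a homogeneous regular sequence of degree a = (a_1,…,a_r). Assume f ⊆ P, where P is an ideal generated by homogeneous elements each of which is a product of linear forms. Then every homogeneous ideal I ⊆ A containing P satisfies EGH_a. In particular, every monomial ideal containing a regular sequence of degree a satisfies EGH_a. -/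
open MvPolynomial

namespace CappedLex

open Finset

/-- Exponent vectors of degree `e` bounded strictly by the caps `c`. -/
def box {n : ℕ} (c : Fin n → ℕ) (e : ℤ) : Finset (Fin n → ℕ) :=
  {m ∈ Fintype.piFinset fun i => range (c i) | ((∑ i, m i : ℕ) : ℤ) = e}

lemma mem_box {n : ℕ} {c : Fin n → ℕ} {e : ℤ} {m : Fin n → ℕ} :
    m ∈ box c e ↔ (∀ i, m i < c i) ∧ ((∑ i, m i : ℕ) : ℤ) = e := by
  simp [box]

/-- The lower shadow: vectors obtained by lowering one coordinate of a member by one. -/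
def shadow {n : ℕ} (M : Finset (Fin n → ℕ)) : Finset (Fin n → ℕ) :=
  M.biUnion fun u => ({i | 0 < u i} : Finset (Fin n)).image fun i => u - Pi.single i 1

lemma mem_shadow {n : ℕ} {M : Finset (Fin n → ℕ)} {w : Fin n → ℕ} :
    w ∈ shadow M ↔ ∃ i, w + Pi.single i 1 ∈ M := by
  simp only [shadow, mem_biUnion, mem_image, mem_filter, mem_univ, true_and]
  constructor
  · rintro ⟨u, hu, i, hi, rfl⟩
    refine ⟨i, ?_⟩
    rwa [tsub_add_cancel_of_le]
    intro j
    rcases eq_or_ne j i with rfl | h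
    · simpa [Nat.one_le_iff_ne_zero, Nat.pos_iff_ne_zero] using hi
    · simp [h]
  · rintro ⟨i, hi⟩
    exact ⟨_, hi, i, by simp, by simp⟩

@[gcongr]
lemma shadow_mono {n : ℕ} {M N : Finset (Fin n → ℕ)} (h : M ⊆ N) : shadow M ⊆ shadow N :=
  biUnion_subset_biUnion_of_subset_left _ h

@[simp] lemma shadow_empty {n : ℕ} : shadow (∅ : Finset (Fin n → ℕ)) = ∅ := rfl

lemma sum_add_single {n : ℕ} (w : Fin n → ℕ) (i : Fin n) :
    ∑ j, (w + Pi.single i 1 : Fin n → ℕ) j = ∑ j, w j + 1 := by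
  simp [sum_add_distrib]

lemma mem_box_of_add_single {n : ℕ} {c : Fin n → ℕ} {e : ℤ} {w : Fin n → ℕ} {i : Fin n}
    (h : w + Pi.single i 1 ∈ box c e) : w ∈ box c (e - 1) := by
  rw [mem_box, sum_add_single] at h
  refine mem_box.2 ⟨fun j => lt_of_le_of_lt ?_ (h.1 j), by push_cast at h ⊢; linarith [h.2]⟩
  simp

lemma shadow_subset_box {n : ℕ} {c : Fin n → ℕ} {e : ℤ} {M : Finset (Fin n → ℕ)}
    (h : M ⊆ box c e) : shadow M ⊆ box c (e - 1) := fun _ hw =>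
  let ⟨_, hi⟩ := mem_shadow.1 hw
  mem_box_of_add_single (h hi)

lemma lex_lt_iff {n : ℕ} {u v : Fin n → ℕ} :
    toLex u < toLex v ↔ ∃ i, (∀ j < i, u j = v j) ∧ u i < v i := Iff.rfl

/-- An initial segment of `box c e` for the lexicographic order. -/
def IsInit {n : ℕ} (c : Fin n → ℕ) (e : ℤ) (D : Finset (Fin n → ℕ)) : Prop :=
  D ⊆ box c e ∧ ∀ u ∈ D, ∀ v ∈ box c e, toLex v < toLex u → v ∈ D

lemma isInit_empty {n : ℕ} (c : Fin n → ℕ) (e : ℤ) : IsInit c e ∅ := by simp [IsInit]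

lemma IsInit.total {n : ℕ} {c : Fin n → ℕ} {e : ℤ} {D E : Finset (Fin n → ℕ)}
    (hD : IsInit c e D) (hE : IsInit c e E) : D ⊆ E ∨ E ⊆ D := by
  by_contra! h
  obtain ⟨u, hu, hu'⟩ := not_subset.1 h.1
  obtain ⟨v, hv, hv'⟩ := not_subset.1 h.2
  rcases lt_trichotomy (toLex u) (toLex v) with h | h | h
  · exact hu' (hE.2 v hv u (hD.1 hu) h)
  · exact hu' (toLex.injective h ▸ hv)
  · exact hv' (hD.2 u hu v (hE.1 hv) h)

lemma IsInit.subset_of_card_le {n : ℕ} {c : Fin n → ℕ} {e : ℤ} {D E : Finset (Fin n → ℕ)}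
    (hD : IsInit c e D) (hE : IsInit c e E) (h : #D ≤ #E) : D ⊆ E := by
  rcases hD.total hE with h' | h'
  · exact h'
  · exact (eq_of_subset_of_card_le h' h).ge

lemma IsInit.card_union_le {n : ℕ} {c : Fin n → ℕ} {e : ℤ} {D E : Finset (Fin n → ℕ)}
    (hD : IsInit c e D) (hE : IsInit c e E) {b : ℕ} (h₁ : #D ≤ b) (h₂ : #E ≤ b) :
    #(D ∪ E) ≤ b := by
  rcases hD.total hE with h | h
  · rwa [union_eq_right.2 h]
  · rwa [union_eq_left.2 h]

lemma exists_isInit {n : ℕ} (c : Fin n → ℕ) (e : ℤ) {k : ℕ} (hk : k ≤ #(box c e)) :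
    ∃ D, IsInit c e D ∧ #D = k := by
  induction k with
  | zero => exact ⟨∅, isInit_empty c e, rfl⟩
  | succ k ih =>
    obtain ⟨D, hD, hDk⟩ := ih (by omega)
    have hne : (box c e \ D).Nonempty := by
      rw [← card_pos, card_sdiff_of_subset hD.1]
      omega
    obtain ⟨u, hu, hmin⟩ := exists_min_image _ toLex hne
    rw [mem_sdiff] at hu
    refine ⟨insert u D, ⟨insert_subset hu.1 hD.1, ?_⟩, by rw [card_insert_of_notMem hu.2, hDk]⟩
    intro x hx v hv hvx
    rw [mem_insert] at hx ⊢
    by_contra! hc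
    rcases hx with rfl | hx
    · exact absurd (hmin v (mem_sdiff.2 ⟨hv, hc.2⟩)) (not_le.2 hvx)
    · exact hc.2 (hD.2 x hx v hv hvx)

lemma toLex_single_lt {n : ℕ} {w : Fin n → ℕ} {i j : Fin n} (h : i < j) :
    toLex (w + Pi.single j 1) < toLex (w + Pi.single i 1) := by
  refine lex_lt_iff.2 ⟨i, fun k hk => ?_, ?_⟩
  · simp [hk.ne, (hk.trans h).ne]
  · simp [h.ne]

lemma IsInit.shadow {n : ℕ} {c : Fin n → ℕ} {e : ℤ} {D : Finset (Fin n → ℕ)}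
    (hD : IsInit c e D) : IsInit c (e - 1) (shadow D) := by
  refine ⟨shadow_subset_box hD.1, fun w hw v hv hvw => ?_⟩
  obtain ⟨i, hi⟩ := mem_shadow.1 hw
  obtain ⟨t, ht, htlt⟩ := lex_lt_iff.1 hvw
  have hwb := mem_box.1 (mem_box_of_add_single (hD.1 hi))
  have hib := mem_box.1 (hD.1 hi)
  have hvb := mem_box.1 hv
  set S : Finset (Fin n) := {k | v k + 1 < c k} with hS
  have htS : t ∈ S := by
    simp only [hS, mem_filter, mem_univ, true_and]
    have := hwb.1 t
    omega
  set j := S.max' ⟨t, htS⟩ with hj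
  have hjS : v j + 1 < c j := by
    have := S.max'_mem ⟨t, htS⟩
    rw [← hj] at this
    simpa [hS] using this
  have htj : t ≤ j := S.le_max' t htS
  have hfull : ∀ k, j < k → v k + 1 = c k := by
    intro k hk
    by_contra hne
    have : k ∈ S := by
      simp only [hS, mem_filter, mem_univ, true_and]
      have := hvb.1 k
      omega
    exact absurd (S.le_max' k this) (not_le.2 hk)
  have hvj : v + Pi.single j 1 ∈ box c e := by
    refine mem_box.2 ⟨fun k => ?_, ?_⟩
    · rcases eq_or_ne k j with rfl | h
      · simpa using hjS
      · simpa [h] using hvb.1 k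
    · rw [sum_add_single]
      push_cast
      have := hvb.2
      push_cast at this
      linarith
  refine mem_shadow.2 ⟨j, ?_⟩
  rcases lt_trichotomy i t with hit | rfl | hti
  · refine hD.2 _ hi _ hvj (lex_lt_iff.2 ⟨i, fun k hk => ?_, ?_⟩)
    · simp [hk.ne, (hk.trans_le (hit.le.trans htj)).ne, ht k (hk.trans hit)]
    · simp [(hit.trans_le htj).ne, ht i hit]
  · refine hD.2 _ hi _ hvj (lex_lt_iff.2 ⟨i, fun k hk => ?_, ?_⟩)
    · simp [hk.ne, (hk.trans_le htj).ne, ht k hk]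
    · have : (Pi.single j 1 : Fin n → ℕ) i ≤ 1 := by
        rcases eq_or_ne i j with h | h <;> simp [h]
      simp only [Pi.add_apply, Pi.single_eq_same]
      omega
  · have key : toLex (v + Pi.single j 1) ≤ toLex (w + Pi.single i 1) := by
      by_contra! hlt
      obtain ⟨s, hs, hslt⟩ := lex_lt_iff.1 hlt
      have hst : t ≤ s := by
        by_contra! hst
        have := ht s hst
        simp [(hst.trans hti).ne, (hst.trans_le htj).ne] at hslt
        omega
      have hjt : j = t := by
        by_contra hne
        have htj' : t < j := lt_of_le_of_ne htj (Ne.symm hne)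
        rcases hst.eq_or_lt with rfl | h
        · simp [hti.ne, htj'.ne] at hslt
          omega
        · have := hs t h
          simp [hti.ne, htj'.ne] at this
          omega
      rw [hjt] at hslt hs hfull
      rcases hst.eq_or_lt with rfl | h
      · simp [hti.ne] at hslt
        omega
      · have hlt : ∑ k, (w + Pi.single i 1 : Fin n → ℕ) k <
            ∑ k, (v + Pi.single j 1 : Fin n → ℕ) k := by
          rw [hjt]
          refine sum_lt_sum (fun k _ => ?_) ⟨s, mem_univ s, hslt⟩
          rcases lt_trichotomy k s with hk | rfl | hk
          · exact (hs k hk).le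
          · exact hslt.le
          · have h1 := hfull k (h.trans hk)
            have h2 := hib.1 k
            rw [Pi.add_apply v, Pi.single_eq_of_ne (h.trans hk).ne']
            omega
        have := hib.2.trans (mem_box.1 hvj).2.symm
        omega
    rcases key.eq_or_lt with h | h
    · exact toLex.injective h ▸ hi
    · exact hD.2 _ hi _ hvj h

/-- Insertion of the coordinate `j` at position `p`. -/
abbrev ins {n : ℕ} (p : Fin (n + 1)) (j : ℕ) (w : Fin n → ℕ) : Fin (n + 1) → ℕ :=
  p.insertNth (α := fun _ => ℕ) j w

lemma exists_eq_ins {n : ℕ} (p : Fin (n + 1)) (u : Fin (n + 1) → ℕ) :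
    ∃ w, u = ins p (u p) w :=
  ⟨p.removeNth u, (Fin.insertNth_self_removeNth p u).symm⟩

lemma ins_injective {n : ℕ} (p : Fin (n + 1)) (j : ℕ) : Function.Injective (ins p j) :=
  Fin.insertNth_right_injective (α := fun _ => ℕ) j

lemma ins_add_single {n : ℕ} (p : Fin (n + 1)) (j : ℕ) (w : Fin n → ℕ) :
    ins p j w + Pi.single p 1 = ins p (j + 1) w := by
  ext k
  rcases Fin.eq_self_or_eq_succAbove p k with rfl | ⟨k, rfl⟩
  · simp [ins]
  · simp [ins]

lemma ins_add_single_succAbove {n : ℕ} (p : Fin (n + 1)) (j : ℕ) (w : Fin n → ℕ) (i : Fin n) :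
    ins p j w + Pi.single (p.succAbove i) 1 = ins p j (w + Pi.single i 1) := by
  ext k
  rcases Fin.eq_self_or_eq_succAbove p k with rfl | ⟨k, rfl⟩
  · simp [ins]
  · simp [ins, Pi.single_apply]

lemma ins_lt_ins {n : ℕ} (p : Fin (n + 1)) (j : ℕ) {w w' : Fin n → ℕ} :
    toLex (ins p j w) < toLex (ins p j w') ↔ toLex w < toLex w' := by
  suffices H : ∀ {w w' : Fin n → ℕ}, toLex w < toLex w' →
      toLex (ins p j w) < toLex (ins p j w') by
    refine ⟨fun h => ?_, H⟩
    rcases lt_trichotomy (toLex w) (toLex w') with h' | h' | h'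
    · exact h'
    · exact absurd (toLex.injective h' ▸ h) (lt_irrefl _)
    · exact absurd (H h') h.not_gt
  intro w w' h
  obtain ⟨i, hi, hlt⟩ := lex_lt_iff.1 h
  refine lex_lt_iff.2 ⟨p.succAbove i, fun k hk => ?_, by simpa [ins] using hlt⟩
  rcases Fin.eq_self_or_eq_succAbove p k with rfl | ⟨k, rfl⟩
  · simp [ins]
  · simpa [ins] using hi k ((Fin.strictMono_succAbove p).lt_iff_lt.1 hk)

lemma ins_mem_box {n : ℕ} {c : Fin (n + 1) → ℕ} {e : ℤ} {p : Fin (n + 1)} {j : ℕ}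
    {w : Fin n → ℕ} :
    ins p j w ∈ box c e ↔ j < c p ∧ w ∈ box (c ∘ p.succAbove) (e - j) := by
  simp only [mem_box, Fin.forall_iff_succAbove p, Fin.sum_univ_succAbove _ p,
    Fin.insertNth_apply_same, Fin.insertNth_apply_succAbove, Function.comp, and_assoc]
  push_cast
  rw [eq_sub_iff_add_eq']

/-- The vectors `w` such that inserting `j` at `p` gives a member of `M`. -/
noncomputable def slice {n : ℕ} (p : Fin (n + 1)) (j : ℕ) (M : Finset (Fin (n + 1) → ℕ)) :
    Finset (Fin n → ℕ) :=
  M.preimage (ins p j) (ins_injective p j).injOn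

@[simp] lemma mem_slice {n : ℕ} {p : Fin (n + 1)} {j : ℕ} {M : Finset (Fin (n + 1) → ℕ)}
    {w : Fin n → ℕ} : w ∈ slice p j M ↔ ins p j w ∈ M := mem_preimage

lemma slice_box {n : ℕ} {c : Fin (n + 1) → ℕ} {e : ℤ} {p : Fin (n + 1)} {j : ℕ}
    (hj : j < c p) : slice p j (box c e) = box (c ∘ p.succAbove) (e - j) := by
  ext w
  simp [ins_mem_box, hj]

lemma slice_subset_box {n : ℕ} {c : Fin (n + 1) → ℕ} {e : ℤ} {M : Finset (Fin (n + 1) → ℕ)}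
    (h : M ⊆ box c e) (p : Fin (n + 1)) (j : ℕ) :
    slice p j M ⊆ box (c ∘ p.succAbove) (e - j) := fun _ hw =>
  (ins_mem_box.1 (h (mem_slice.1 hw))).2

lemma slice_eq_empty {n : ℕ} {c : Fin (n + 1) → ℕ} {e : ℤ} {M : Finset (Fin (n + 1) → ℕ)}
    (h : M ⊆ box c e) {p : Fin (n + 1)} {j : ℕ} (hj : c p ≤ j) : slice p j M = ∅ := by
  refine eq_empty_of_forall_notMem fun w hw => ?_
  have := (ins_mem_box.1 (h (mem_slice.1 hw))).1
  omega

lemma card_eq_sum_slice {n : ℕ} {c : Fin (n + 1) → ℕ} {e : ℤ} {M : Finset (Fin (n + 1) → ℕ)}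
    (h : M ⊆ box c e) (p : Fin (n + 1)) : #M = ∑ j ∈ range (c p), #(slice p j M) := by
  rw [card_eq_sum_card_fiberwise (f := fun u => u p) (t := range (c p))
    fun u hu => by simpa using (mem_box.1 (h hu)).1 p]
  refine sum_congr rfl fun j _ => ?_
  rw [← card_image_of_injective (slice p j M) (ins_injective p j)]
  congr 1
  ext u
  simp only [mem_filter, mem_image, mem_slice]
  constructor
  · rintro ⟨hu, rfl⟩
    obtain ⟨w, hw⟩ := exists_eq_ins p u
    exact ⟨w, hw ▸ hu, hw.symm⟩
  · rintro ⟨w, hw, rfl⟩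
    exact ⟨hw, by simp [ins]⟩

lemma slice_shadow {n : ℕ} (p : Fin (n + 1)) (j : ℕ) (M : Finset (Fin (n + 1) → ℕ)) :
    slice p j (shadow M) = shadow (slice p j M) ∪ slice p (j + 1) M := by
  ext w
  simp only [mem_slice, mem_union, mem_shadow, Fin.exists_iff_succAbove p, ins_add_single,
    ins_add_single_succAbove]
  exact or_comm

lemma IsInit.slice {n : ℕ} {c : Fin (n + 1) → ℕ} {e : ℤ} {D : Finset (Fin (n + 1) → ℕ)}
    (hD : IsInit c e D) {p : Fin (n + 1)} {j : ℕ} :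
    IsInit (c ∘ p.succAbove) (e - j) (slice p j D) := by
  refine ⟨slice_subset_box hD.1 p j, fun u hu v hv hvu => ?_⟩
  rw [mem_slice] at hu ⊢
  exact hD.2 _ hu _ (ins_mem_box.2 ⟨(ins_mem_box.1 (hD.1 hu)).1, hv⟩) ((ins_lt_ins p j).2 hvu)

/-- The set whose slices at `p` are `D 0, …, D (k - 1)`. -/
def assemble {n : ℕ} (p : Fin (n + 1)) (k : ℕ) (D : ℕ → Finset (Fin n → ℕ)) :
    Finset (Fin (n + 1) → ℕ) :=
  (range k).biUnion fun j => (D j).image (ins p j)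

lemma ins_mem_assemble {n : ℕ} {p : Fin (n + 1)} {k j : ℕ} {D : ℕ → Finset (Fin n → ℕ)}
    {w : Fin n → ℕ} : ins p j w ∈ assemble p k D ↔ j < k ∧ w ∈ D j := by
  simp only [assemble, mem_biUnion, mem_range, mem_image]
  constructor
  · rintro ⟨j', hj', w', hw', h⟩
    obtain ⟨rfl, rfl⟩ := (Fin.insertNth_injective2 (α := fun _ => ℕ)) h
    exact ⟨hj', hw'⟩
  · rintro ⟨hj, hw⟩
    exact ⟨j, hj, w, hw, rfl⟩

lemma assemble_subset_box {n : ℕ} {c : Fin (n + 1) → ℕ} {e : ℤ} {p : Fin (n + 1)}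
    {D : ℕ → Finset (Fin n → ℕ)} (hD : ∀ j, D j ⊆ box (c ∘ p.succAbove) (e - j)) :
    assemble p (c p) D ⊆ box c e := by
  intro u hu
  obtain ⟨w, hw⟩ := exists_eq_ins p u
  rw [hw] at hu ⊢
  rw [ins_mem_assemble] at hu
  exact ins_mem_box.2 ⟨hu.1, hD _ hu.2⟩

lemma slice_assemble {n : ℕ} {p : Fin (n + 1)} {k j : ℕ} {D : ℕ → Finset (Fin n → ℕ)}
    (hj : j < k) : slice p j (assemble p k D) = D j := by
  ext w
  simp [ins_mem_assemble, hj]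

lemma card_assemble {n : ℕ} {c : Fin (n + 1) → ℕ} {e : ℤ} {p : Fin (n + 1)}
    {D : ℕ → Finset (Fin n → ℕ)} (hD : ∀ j, D j ⊆ box (c ∘ p.succAbove) (e - j)) :
    #(assemble p (c p) D) = ∑ j ∈ range (c p), #(D j) := by
  rw [card_eq_sum_slice (assemble_subset_box hD) p]
  exact sum_congr rfl fun j hj => by rw [slice_assemble (mem_range.1 hj)]

lemma card_shadow_assemble_le {n : ℕ} {c : Fin (n + 1) → ℕ} {e : ℤ} {p : Fin (n + 1)}
    {D : ℕ → Finset (Fin n → ℕ)} (hD : ∀ j : ℕ, IsInit (c ∘ p.succAbove) (e - j) (D j))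
    {b : ℕ → ℕ} (h₁ : ∀ j, #(shadow (D j)) ≤ b j) (h₂ : ∀ j, #(D (j + 1)) ≤ b j) :
    #(shadow (assemble p (c p) D)) ≤ ∑ j ∈ range (c p), b j := by
  have hA := assemble_subset_box fun j : ℕ => (hD j).1
  rw [card_eq_sum_slice (shadow_subset_box hA) p]
  refine sum_le_sum fun j hj => ?_
  rw [slice_shadow, slice_assemble (mem_range.1 hj)]
  have hsh : IsInit (c ∘ p.succAbove) (e - 1 - j) (shadow (D j)) := by
    convert (hD j).shadow using 1
    ring
  rcases lt_or_ge (j + 1) (c p) with h | h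
  · rw [slice_assemble h]
    refine hsh.card_union_le ?_ (h₁ j) (h₂ j)
    convert hD (j + 1) using 1
    push_cast
    ring
  · rw [slice_eq_empty hA h, union_empty]
    exact h₁ j

lemma card_add_card_shadow_slice_last_le {n : ℕ} {c : Fin (n + 1) → ℕ} {e : ℤ}
    {M : Finset (Fin (n + 1) → ℕ)} (hM : M ⊆ box c e) {t : ℕ} (ht : c (Fin.last n) = t + 1) :
    #M + #(shadow (slice (Fin.last n) t M)) ≤ #(shadow M) + #(slice (Fin.last n) 0 M) := by
  rw [card_eq_sum_slice hM (Fin.last n), card_eq_sum_slice (shadow_subset_box hM) (Fin.last n), ht,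
    sum_range_succ', sum_range_succ (fun j => #(slice (Fin.last n) j (shadow M)))]
  have h₁ : ∑ j ∈ range t, #(slice (Fin.last n) (j + 1) M) ≤
      ∑ j ∈ range t, #(slice (Fin.last n) j (shadow M)) := sum_le_sum fun j _ => by
    rw [slice_shadow]
    exact card_le_card subset_union_right
  have h₂ : #(shadow (slice (Fin.last n) t M)) ≤ #(slice (Fin.last n) t (shadow M)) := by
    rw [slice_shadow]
    exact card_le_card subset_union_left
  omega

lemma IsInit.card_shadow_add_card_slice_last_le {n : ℕ} {c : Fin (n + 1) → ℕ} {e : ℤ}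
    {D : Finset (Fin (n + 1) → ℕ)} (hD : IsInit c e D) {t : ℕ} (ht : c (Fin.last n) = t + 1) :
    #(CappedLex.shadow D) + #(CappedLex.slice (Fin.last n) 0 D) ≤
      #D + #(CappedLex.shadow (CappedLex.slice (Fin.last n) t D)) := by
  rw [card_eq_sum_slice hD.1 (Fin.last n), card_eq_sum_slice (shadow_subset_box hD.1) (Fin.last n),
    ht, sum_range_succ' (fun j => #(CappedLex.slice (Fin.last n) j D)),
    sum_range_succ (fun j => #(CappedLex.slice (Fin.last n) j (CappedLex.shadow D)))]
  have h₁ : ∑ j ∈ range t, #(CappedLex.slice (Fin.last n) j (CappedLex.shadow D)) ≤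
      ∑ j ∈ range t, #(CappedLex.slice (Fin.last n) (j + 1) D) := sum_le_sum fun j hj => by
    rw [slice_shadow, union_eq_right.2]
    intro w hw
    obtain ⟨i, hi⟩ := mem_shadow.1 hw
    rw [mem_slice, ← ins_add_single_succAbove] at hi
    rw [mem_slice, ← ins_add_single]
    refine hD.2 _ hi _ ?_ (toLex_single_lt (by simp))
    have hb := mem_box.1 (hD.1 hi)
    have hb' := (mem_box.1 (mem_box_of_add_single (hD.1 hi))).1
    rw [sum_add_single] at hb
    refine mem_box.2 ⟨fun k => ?_, by rw [sum_add_single]; exact hb.2⟩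
    rcases eq_or_ne k (Fin.last n) with rfl | hk
    · have := mem_range.1 hj
      simp [ins, ht, this]
    · simpa [hk] using hb' k
  have h₂ : #(CappedLex.slice (Fin.last n) t (CappedLex.shadow D)) ≤
      #(CappedLex.shadow (CappedLex.slice (Fin.last n) t D)) := by
    rw [slice_shadow, slice_eq_empty hD.1 ht.le, union_empty]
  omega

/-- Moving one unit from coordinate `i` to coordinate `j`. -/
lemma exists_move {n : ℕ} {c : Fin n → ℕ} {e : ℤ} {u : Fin n → ℕ} (hu : u ∈ box c e)
    {i j : Fin n} (hij : i ≠ j) (hi : 0 < u i) (hj : u j + 1 < c j) :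
    ∃ v ∈ box c e, v i + 1 = u i ∧ v j = u j + 1 ∧ (∀ k, k ≠ i → k ≠ j → v k = u k) ∧
      (i < j → toLex v < toLex u) ∧ (j < i → toLex u < toLex v) := by
  have hw : u - Pi.single i 1 + Pi.single i 1 = u := by
    refine tsub_add_cancel_of_le fun k => ?_
    rcases eq_or_ne k i with rfl | h
    · simpa [Nat.one_le_iff_ne_zero, Nat.pos_iff_ne_zero] using hi
    · simp [h]
  have hb := mem_box.1 hu
  refine ⟨u - Pi.single i 1 + Pi.single j 1, mem_box.2 ⟨fun k => ?_, ?_⟩, ?_, ?_, ?_, ?_, ?_⟩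
  · rcases eq_or_ne k j with rfl | h
    · simp [hij.symm, hj]
    · have := hb.1 k
      simp only [Pi.add_apply, Pi.sub_apply, Pi.single_eq_of_ne h]
      omega
  · rw [sum_add_single, ← sum_add_single _ i, hw]
    exact hb.2
  · simp only [Pi.add_apply, Pi.sub_apply, Pi.single_eq_same, Pi.single_eq_of_ne hij]
    omega
  · simp [hij.symm]
  · intro k hki hkj
    simp [hki, hkj]
  · intro h
    conv_rhs => rw [← hw]
    exact toLex_single_lt h
  · intro h
    conv_lhs => rw [← hw]
    exact toLex_single_lt h

lemma eq_of_le_of_mem_box {n : ℕ} {c : Fin n → ℕ} {e : ℤ} {u v : Fin n → ℕ} (hu : u ∈ box c e)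
    (hv : v ∈ box c e) (h : ∀ i, u i ≤ v i) : u = v := by
  have := (mem_box.1 hu).2.trans (mem_box.1 hv).2.symm
  exact funext fun i => (sum_eq_sum_iff_of_le fun i _ => h i).1 (by exact_mod_cast this) i
    (mem_univ i)

/-- A set of exponent vectors is compressed if, within each coordinate hyperplane, it is an
initial segment. -/
def IsCompressed {n : ℕ} (c : Fin n → ℕ) (e : ℤ) (M : Finset (Fin n → ℕ)) : Prop :=
  M ⊆ box c e ∧ ∀ p, ∀ u ∈ M, ∀ v ∈ box c e, v p = u p → toLex v < toLex u → v ∈ M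

lemma lex_lt_of_zero {n : ℕ} {u v : Fin (n + 1) → ℕ} (h : u 0 < v 0) : toLex u < toLex v :=
  lex_lt_iff.2 ⟨0, fun k hk => absurd hk (Fin.not_lt_zero k), h⟩

lemma zero_le_of_lex_lt {n : ℕ} {u v : Fin (n + 1) → ℕ} (h : toLex u < toLex v) : u 0 ≤ v 0 := by
  by_contra! h'
  exact (lex_lt_of_zero h').not_gt h

lemma IsCompressed.mem_of_lt_of_last_eq_zero {n : ℕ} {c : Fin (n + 3) → ℕ} {e : ℤ}
    {M : Finset (Fin (n + 3) → ℕ)} (hM : IsCompressed c e M) {u w : Fin (n + 3) → ℕ}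
    (hu : u ∈ M) (hu0 : u (Fin.last _) = 0) (hw : w ∈ box c e) (hlt : toLex w < toLex u) :
    w ∈ M := by
  rcases (zero_le_of_lex_lt hlt).eq_or_lt with h0 | h0
  · exact hM.2 0 u hu w hw h0 hlt
  clear hlt
  have h1l : (1 : Fin (n + 3)) < Fin.last _ := by simp [Fin.lt_def]
  induction hk : w (Fin.last _) generalizing w with
  | zero => exact hM.2 _ u hu w hw (hk.trans hu0.symm) (lex_lt_of_zero h0)
  | succ k ih =>
    by_cases hmid : ∃ i, 0 < i ∧ i < Fin.last _ ∧ w i + 1 < c i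
    · obtain ⟨i, hi0, hil, hi⟩ := hmid
      obtain ⟨w', hw', h1, h2, h3, -, h5⟩ := exists_move hw hil.ne' (by omega) hi
      have hz := h3 0 (by simp [Fin.ext_iff]) hi0.ne
      exact hM.2 0 w' (ih hw' (by omega) (by omega)) w hw hz.symm (h5 hil)
    push Not at hmid
    clear ih
    induction hm : u 0 using Nat.strong_induction_on generalizing u with
    | _ m ihm =>
      subst hm
      by_cases hmid' : ∃ i, 0 < i ∧ i < Fin.last _ ∧ u i + 1 < c i
      · obtain ⟨i, hi0, hil, hi⟩ := hmid'
        obtain ⟨u', hu', h1, h2, h3, h4, -⟩ := exists_move (hM.1 hu) hi0.ne (by omega) hi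
        have hl := h3 (Fin.last _) (by simp [Fin.ext_iff]) hil.ne'
        have hu'M := hM.2 _ u hu u' hu' hl (h4 hi0)
        rcases Nat.lt_or_ge (w 0) (u' 0) with h | h
        · exact ihm (u' 0) (by omega) hu'M (by omega) h rfl
        · have heq : u' = w := eq_of_le_of_mem_box hu' hw fun j => by
            rcases (Fin.zero_le j).eq_or_lt with rfl | hj0
            · exact h
            rcases (Fin.le_last j).eq_or_lt with rfl | hjl
            · omega
            · have := hmid j hj0 hjl
              have := (mem_box.1 hu').1 j
              omega
          exact heq ▸ hu'M
      · push Not at hmid'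
        refine hM.2 1 u hu w hw ?_ (lex_lt_of_zero h0)
        have h1 := hmid 1 (by simp) h1l
        have h2 := hmid' 1 (by simp) h1l
        have h3 := (mem_box.1 hw).1 1
        have h4 := (mem_box.1 (hM.1 hu)).1 1
        omega

lemma IsCompressed.mem_of_lt_of_last_eq_top {n : ℕ} {c : Fin (n + 3) → ℕ} {e : ℤ}
    {M : Finset (Fin (n + 3) → ℕ)} (hM : IsCompressed c e M) {v w : Fin (n + 3) → ℕ}
    (hw : w ∈ M) (hv : v ∈ box c e) (hvt : v (Fin.last _) + 1 = c (Fin.last _))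
    (hlt : toLex v < toLex w) : v ∈ M := by
  rcases (zero_le_of_lex_lt hlt).eq_or_lt with h0 | h0
  · exact hM.2 0 w hw v hv h0 hlt
  clear hlt
  have h1l : (1 : Fin (n + 3)) < Fin.last _ := by simp [Fin.lt_def]
  induction hk : v (Fin.last _) - w (Fin.last _) generalizing w with
  | zero =>
    have := (mem_box.1 (hM.1 hw)).1 (Fin.last _)
    exact hM.2 (Fin.last _) w hw v hv (by omega) (lex_lt_of_zero h0)
  | succ k ih =>
    by_cases hmid : ∃ i, 0 < i ∧ i < Fin.last _ ∧ 0 < w i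
    · obtain ⟨i, hi0, hil, hi⟩ := hmid
      obtain ⟨w', hw', h1, h2, h3, h4, -⟩ := exists_move (hM.1 hw) hil.ne hi (by omega)
      have hz := h3 0 hi0.ne (by simp [Fin.ext_iff])
      exact ih (hM.2 0 w hw w' hw' hz (h4 hil)) (by omega) (by omega)
    push Not at hmid
    obtain ⟨w', hw', h1, h2, h3, h4, -⟩ := exists_move (hM.1 hw) (i := 0) (j := Fin.last _)
      (by simp [Fin.ext_iff]) (by omega) (by omega)
    have hw'M := hM.2 1 w hw w' hw' (h3 1 (by simp) h1l.ne) (h4 (Fin.last_pos))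
    rcases Nat.lt_or_ge (v 0) (w' 0) with h | h
    · exact ih hw'M h (by omega)
    · have heq : w' = v := eq_of_le_of_mem_box hw' hv fun j => by
        rcases (Fin.zero_le j).eq_or_lt with rfl | hj0
        · exact h
        rcases (Fin.le_last j).eq_or_lt with rfl | hjl
        · omega
        · have := hmid j hj0 hjl
          have := h3 j hj0.ne' hjl.ne
          omega
      exact heq ▸ hw'M

lemma IsCompressed.card_shadow_le {n : ℕ} {c : Fin (n + 3) → ℕ} {e : ℤ}
    {M D : Finset (Fin (n + 3) → ℕ)} (hM : IsCompressed c e M) (hD : IsInit c e D)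
    (h : #D = #M) : #(shadow D) ≤ #(shadow M) := by
  obtain ht | ⟨t, ht⟩ : c (Fin.last _) = 0 ∨ ∃ t, c (Fin.last _) = t + 1 := by
    rcases c (Fin.last _) with _ | t <;> simp
  · have : D = ∅ := eq_empty_of_forall_notMem fun u hu => by
      have := (mem_box.1 (hD.1 hu)).1 (Fin.last _)
      omega
    simp [this]
  have h₁ := card_add_card_shadow_slice_last_le hM.1 ht
  have h₂ := hD.card_shadow_add_card_slice_last_le ht
  have h₃ : slice (Fin.last _) 0 M ⊆ slice (Fin.last _) 0 D := by
    intro w hw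
    by_contra hwD
    rw [mem_slice] at hw hwD
    have hlt : D ⊂ M := by
      refine (ssubset_iff_of_subset fun v hv => ?_).2 ⟨_, hw, hwD⟩
      refine hM.mem_of_lt_of_last_eq_zero hw (by simp [ins]) (hD.1 hv) ?_
      by_contra hle
      rcases (not_lt.1 hle).eq_or_lt with heq | hlt
      · exact hwD (toLex.injective heq ▸ hv)
      · exact hwD (hD.2 v hv _ (hM.1 hw) hlt)
    exact (card_lt_card hlt).ne h
  have h₄ : slice (Fin.last _) t D ⊆ slice (Fin.last _) t M := by
    intro w hw
    by_contra hwM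
    rw [mem_slice] at hw hwM
    have hlt : M ⊂ D := by
      refine (ssubset_iff_of_subset fun v hv => ?_).2 ⟨_, hw, hwM⟩
      refine hD.2 _ hw v (hM.1 hv) ?_
      by_contra hle
      rcases (not_lt.1 hle).eq_or_lt with heq | hlt
      · exact hwM (toLex.injective heq ▸ hv)
      · exact hwM (hM.mem_of_lt_of_last_eq_top hv (hD.1 hw) (by simp [ins, ht]) hlt)
    exact (card_lt_card hlt).ne' h
  have h₅ := card_le_card h₃
  have h₆ := card_le_card (shadow_mono h₄)
  omega

lemma sub_single_mem_shadow {n : ℕ} {M : Finset (Fin n → ℕ)} {u : Fin n → ℕ} (hu : u ∈ M)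
    {i : Fin n} (hi : 0 < u i) : u - Pi.single i 1 ∈ shadow M := by
  simp only [shadow, mem_biUnion, mem_image, mem_filter, mem_univ, true_and]
  exact ⟨u, hu, i, hi, rfl⟩

/-- The size of the shadow of an initial segment is minimal among sets of the same size. -/
def ShadowMinimal {n : ℕ} (c : Fin n → ℕ) : Prop :=
  ∀ (e : ℤ) (M D : Finset (Fin n → ℕ)), M ⊆ box c e → IsInit c e D → #D = #M →
    #(shadow D) ≤ #(shadow M)

lemma exists_isCompressed {n : ℕ} {c : Fin (n + 1) → ℕ} {e : ℤ}
    (hc : ∀ p : Fin (n + 1), ShadowMinimal (c ∘ p.succAbove))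
    {M : Finset (Fin (n + 1) → ℕ)} (hM : M ⊆ box c e) :
    ∃ N, IsCompressed c e N ∧ #N = #M ∧ #(shadow N) ≤ #(shadow M) := by
  classical
  set S : Finset (Finset (Fin (n + 1) → ℕ)) :=
    {N ∈ (box c e).powerset | #N = #M ∧ #(shadow N) ≤ #(shadow M)} with hS
  have hMS : M ∈ S := by simp [hS, hM]
  obtain ⟨N, hN, hmin⟩ := exists_min_image S
    (fun N => toColex (N.map (toLex (α := Fin (n + 1) → ℕ)).toEmbedding)) ⟨M, hMS⟩
  simp only [hS, mem_filter, mem_powerset] at hN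
  obtain ⟨hNb, hNM, hNsh⟩ := hN
  refine ⟨N, ⟨hNb, fun p => ?_⟩, hNM, hNsh⟩
  have hex (j : ℕ) : ∃ D, IsInit (c ∘ p.succAbove) (e - j) D ∧ #D = #(slice p j N) :=
    exists_isInit _ _ (card_le_card (slice_subset_box hNb p j))
  choose D hD hDcard using hex
  have hDb : ∀ j, D j ⊆ box (c ∘ p.succAbove) (e - j) := fun j => (hD j).1
  have hcard : #(assemble p (c p) D) = #N := by
    rw [card_assemble hDb, card_eq_sum_slice hNb p]
    exact sum_congr rfl fun j _ => hDcard j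
  have hsh : #(shadow (assemble p (c p) D)) ≤ #(shadow N) := by
    rw [card_eq_sum_slice (shadow_subset_box hNb) p]
    refine card_shadow_assemble_le hD (fun j => ?_) fun j => ?_
    · rw [slice_shadow]
      exact (hc p _ _ _ (slice_subset_box hNb p j) (hD j) (hDcard j)).trans
        (card_le_card subset_union_left)
    · rw [slice_shadow, hDcard]
      exact card_le_card subset_union_right
  have hle := hmin (assemble p (c p) D) (by
    simp only [hS, mem_filter, mem_powerset]
    exact ⟨assemble_subset_box hDb, hcard.trans hNM, hsh.trans hNsh⟩)
  have hge : toColex ((assemble p (c p) D).map (toLex (α := Fin (n + 1) → ℕ)).toEmbedding) ≤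
      toColex (N.map (toLex (α := Fin (n + 1) → ℕ)).toEmbedding) := by
    rw [Finset.Colex.toColex_le_toColex]
    intro x hx hxN
    obtain ⟨u, hu, rfl⟩ := mem_map.1 hx
    obtain ⟨w, hw⟩ := exists_eq_ins p u
    replace hxN : u ∉ N := fun h => hxN (mem_map_of_mem _ h)
    rw [hw] at hu hxN
    have hu' := (ins_mem_assemble.1 hu)
    have hns : ¬ slice p (u p) N ⊆ D (u p) := fun h =>
      hxN (mem_slice.1 (eq_of_subset_of_card_le h (hDcard _).le ▸ hu'.2))
    obtain ⟨w', hw', hw'D⟩ := not_subset.1 hns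
    refine ⟨toLex (ins p (u p) w'), mem_map_of_mem _ (mem_slice.1 hw'), fun h => ?_, ?_⟩
    · obtain ⟨y, hy, hy'⟩ := mem_map.1 h
      rw [toLex.injective hy'] at hy
      exact hw'D (ins_mem_assemble.1 hy).2
    · change toLex u ≤ _
      by_contra hlt
      rw [not_le, hw] at hlt
      simp only [ins, Fin.insertNth_apply_same] at hlt
      exact hw'D ((hD _).2 w hu'.2 w' (slice_subset_box hNb p _ hw') ((ins_lt_ins p _).1 hlt))
  have heq : N = assemble p (c p) D := map_injective _ (toColex_inj.1 (hle.antisymm hge))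
  intro u hu v hv hvp hlt
  obtain ⟨w, hw⟩ := exists_eq_ins p u
  obtain ⟨w', hw'⟩ := exists_eq_ins p v
  rw [hvp] at hw'
  rw [heq] at hu ⊢
  rw [hw, hw'] at hlt
  rw [hw] at hu
  rw [hw'] at hv ⊢
  rw [ins_mem_assemble] at hu ⊢
  exact ⟨hu.1, (hD _).2 w hu.2 w' (ins_mem_box.1 hv).2 ((ins_lt_ins p _).1 hlt)⟩

lemma shadowMinimal_of_box_subsingleton {n : ℕ} {c : Fin n → ℕ}
    (h : ∀ e, (box c e : Set (Fin n → ℕ)).Subsingleton) : ShadowMinimal c := by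
  intro e M D hM hD hcard
  suffices D = M by rw [this]
  rcases M.eq_empty_or_nonempty with rfl | ⟨u, hu⟩
  · simpa using hcard
  · refine eq_of_subset_of_card_le (fun v hv => ?_) hcard.ge
    exact h e (hM hu) (hD.1 hv) ▸ hu

lemma card_add_one_le_card_shadow {c : Fin 2 → ℕ} (hc : c 0 ≤ c 1) {e : ℤ}
    {M : Finset (Fin 2 → ℕ)} (hM : M ⊆ box c e) (hne : M.Nonempty) (he : c 1 ≤ e) :
    #M + 1 ≤ #(shadow M) := by
  obtain ⟨u, hu, hmin⟩ := exists_min_image M (fun u => u 0) hne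
  have hpos : ∀ v ∈ M, 0 < v 0 ∧ 0 < v 1 ∧ (v 0 + v 1 : ℤ) = e := fun v hv => by
    have := mem_box.1 (hM hv)
    simp only [Fin.forall_fin_two, Fin.sum_univ_two] at this
    push_cast at this
    omega
  have hinj : Set.InjOn (fun v : Fin 2 → ℕ => v - Pi.single 1 1) M := fun v hv w hw h => by
    have h0 := congrFun h 0
    have hv := hpos v hv
    have hw := hpos w hw
    simp at h0
    funext i
    fin_cases i
    · exact h0
    · simp
      omega
  rw [← card_image_of_injOn hinj, ← card_insert_of_notMem (a := u - Pi.single 0 1)]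
  · refine card_le_card (insert_subset (sub_single_mem_shadow hu (hpos u hu).1) ?_)
    rw [image_subset_iff]
    exact fun v hv => sub_single_mem_shadow hv (hpos v hv).2.1
  · rw [mem_image]
    rintro ⟨v, hv, h⟩
    have h0 := congrFun h 0
    have := hmin v hv
    have := hpos u hu
    simp at h0
    omega

lemma card_le_card_shadow {c : Fin 2 → ℕ} {e : ℤ}
    {M : Finset (Fin 2 → ℕ)} (hM : M ⊆ box c e) {g : Fin 2 → ℕ} (hg : g ∈ box c e)
    (hgM : g ∉ M) : #M ≤ #(shadow M) := by
  have hsum : ∀ v ∈ box c e, (v 0 + v 1 : ℤ) = e := fun v hv => by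
    have := mem_box.1 hv
    simp only [Fin.sum_univ_two] at this
    push_cast at this
    exact this.2
  have hne : ∀ v ∈ M, v 0 ≠ g 0 := fun v hv h => hgM <| by
    have h1 := hsum v (hM hv)
    have h2 := hsum g hg
    convert hv using 1
    funext i
    fin_cases i <;> simp <;> omega
  refine card_le_card_of_injOn
    (fun v => if v 0 < g 0 then v - Pi.single 1 1 else v - Pi.single 0 1) (fun v hv => ?_)
    fun v hv w hw h => ?_
  · have h1 := hsum v (hM hv)
    have h2 := hsum g hg
    have h3 := hne v hv
    dsimp only
    split_ifs
    · exact sub_single_mem_shadow hv (by omega)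
    · exact sub_single_mem_shadow hv (by omega)
  · have h0 := congrFun h 0
    have h1 := hsum v (hM hv)
    have h2 := hsum w (hM hw)
    have h3 := hne v hv
    have h4 := hne w hw
    have : v 0 = w 0 := by
      dsimp only at h0
      split_ifs at h0 <;> simp at h0 <;> omega
    funext i
    fin_cases i <;> simp <;> omega

lemma shadowMinimal_two {c : Fin 2 → ℕ} (hc : c 0 ≤ c 1) : ShadowMinimal c := by
  intro e M D hM hD hcard
  rcases M.eq_empty_or_nonempty with rfl | hne
  · rw [card_eq_zero.1 hcard]
  by_cases hall : box c e ⊆ M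
  · rw [eq_of_subset_of_card_le (hD.1.trans hall) hcard.ge]
  obtain ⟨g, hg, hgM⟩ := not_subset.1 hall
  obtain ⟨t, ht⟩ : ∃ t, c (Fin.last 1) = t + 1 := by
    have := (mem_box.1 hg).1 (Fin.last 1)
    exact ⟨c (Fin.last 1) - 1, by omega⟩
  have h₁ := hD.card_shadow_add_card_slice_last_le ht
  have hsl : ∀ w ∈ slice (Fin.last 1) t D, (w 0 : ℤ) = e - t := fun w hw => by
    have := mem_box.1 (slice_subset_box hD.1 _ _ hw)
    simpa using this.2
  have h₂ : #(shadow (slice (Fin.last 1) t D)) ≤ 1 := by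
    refine card_le_one.2 fun w hw w' hw' => ?_
    obtain ⟨i, hi⟩ := mem_shadow.1 hw
    obtain ⟨i', hi'⟩ := mem_shadow.1 hw'
    have h3 := hsl _ hi
    have h4 := hsl _ hi'
    rw [Subsingleton.elim i 0] at h3
    rw [Subsingleton.elim i' 0] at h4
    simp at h3 h4
    funext k
    rw [Subsingleton.elim k 0]
    omega
  change c 1 = t + 1 at ht
  rcases le_or_gt (c 1 : ℤ) e with he | he
  · have := card_add_one_le_card_shadow hc hM hne he
    omega
  · have h3 := card_le_card_shadow hM hg hgM
    have h4 : shadow (slice (Fin.last 1) t D) = ∅ := by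
      refine eq_empty_of_forall_notMem fun w hw => ?_
      obtain ⟨i, hi⟩ := mem_shadow.1 hw
      have h3 := hsl _ hi
      rw [Subsingleton.elim i 0] at h3
      simp at h3
      omega
    rw [h4, card_empty] at h₁
    omega

/-- Clements–Lindström: in a box with increasing caps, initial lex segments have the smallest
shadows. -/
theorem shadowMinimal_of_monotone {n : ℕ} {c : Fin n → ℕ} (hc : Monotone c) :
    ShadowMinimal c := by
  induction n with
  | zero => exact shadowMinimal_of_box_subsingleton fun e u _ v _ => Subsingleton.elim u v
  | succ n ih =>
    rcases n with _ | _ | n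
    · refine shadowMinimal_of_box_subsingleton fun e u hu v hv => funext fun k => ?_
      have h1 := (mem_box.1 hu).2.trans (mem_box.1 hv).2.symm
      obtain rfl : k = 0 := Fin.fin_one_eq_zero k
      simpa using h1
    · exact shadowMinimal_two (hc (Fin.zero_le 1))
    · intro e M D hM hD hcard
      obtain ⟨N, hN, hNM, hsh⟩ := exists_isCompressed
        (fun p => ih (hc.comp (Fin.strictMono_succAbove p).monotone)) hM
      exact (hN.card_shadow_le hD (hcard.trans hNM.symm)).trans hsh

section Grading

variable {K : Type*} [Field K] {n : ℕ}

lemma homogeneousComponent_mul_of_isHomogeneous {k : ℕ} {p : MvPolynomial (Fin n) K}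
    (hp : p.IsHomogeneous k) (a : MvPolynomial (Fin n) K) (e : ℕ) :
    homogeneousComponent e (a * p) = if k ≤ e then homogeneousComponent (e - k) a * p else 0 := by
  let _ := gradedAlgebra (σ := Fin n) (R := K)
  have H (q : MvPolynomial (Fin n) K) (i : ℕ) :
      (DirectSum.decompose (homogeneousSubmodule (Fin n) K) q i : MvPolynomial (Fin n) K) =
        homogeneousComponent i q := decomposition.decompose'_apply q i
  rw [← H, ← H]
  exact DirectSum.coe_decompose_mul_of_right_mem _ e hp

/-- Membership of the graded pieces of an ideal generated by homogeneous elements. -/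
lemma homogeneousComponent_mem_of_mem_span {G : Set (MvPolynomial (Fin n) K)}
    {Q : Ideal (MvPolynomial (Fin n) K)} {e : ℕ}
    (hG : ∀ p ∈ G, ∃ k, p.IsHomogeneous k ∧ (k ≤ e → p ∈ Q)) {x : MvPolynomial (Fin n) K}
    (hx : x ∈ Ideal.span G) : homogeneousComponent e x ∈ Q := by
  induction hx using Submodule.closure_induction with
  | zero => simp
  | add x y _ _ hx hy => rw [map_add]; exact Q.add_mem hx hy
  | smul_mem a p hp =>
    obtain ⟨k, hk, hpQ⟩ := hG p hp
    rw [smul_eq_mul, homogeneousComponent_mul_of_isHomogeneous hk]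
    split_ifs with h
    · exact Q.mul_mem_left _ (hpQ h)
    · exact Q.zero_mem

lemma isHomog_span {G : Set (MvPolynomial (Fin n) K)} (hG : ∀ p ∈ G, ∃ k, p.IsHomogeneous k) :
    IsHomog (Ideal.span G) := fun _ hx _ =>
  homogeneousComponent_mem_of_mem_span (fun p hp =>
    let ⟨k, hk⟩ := hG p hp
    ⟨k, hk, fun _ => Ideal.subset_span hp⟩) hx

end Grading

section Hilbert

variable {K : Type*} [Field K] {n : ℕ}

/-- The graded piece of integer degree `e`. -/
noncomputable def gr (K : Type*) [Field K] (n : ℕ) (e : ℤ) :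
    Submodule K (MvPolynomial (Fin n) K) :=
  if 0 ≤ e then homogeneousSubmodule (Fin n) K e.toNat else ⊥

lemma gr_natCast (e : ℕ) : gr K n e = homogeneousSubmodule (Fin n) K e := by simp [gr]

instance (e : ℤ) : FiniteDimensional K (gr K n e) := by
  refine Module.Finite.of_fg ?_
  rw [gr]
  split_ifs
  · exact homogeneousSubmodule_fg _ _ _
  · exact Submodule.fg_bot

/-- The projection to the graded piece of integer degree `e`. -/
noncomputable def proj (e : ℤ) : MvPolynomial (Fin n) K →ₗ[K] MvPolynomial (Fin n) K :=
  if 0 ≤ e then homogeneousComponent e.toNat else 0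

lemma proj_mem (e : ℤ) (x : MvPolynomial (Fin n) K) : proj e x ∈ gr K n e := by
  rw [proj, gr]
  split_ifs
  · exact homogeneousComponent_mem _ _
  · exact Submodule.zero_mem _

lemma proj_of_mem {e : ℤ} {x : MvPolynomial (Fin n) K} (hx : x ∈ gr K n e) : proj e x = x := by
  rw [gr] at hx
  rw [proj]
  split_ifs with h
  · rw [if_pos h] at hx
    exact homogeneousComponent_eq_self hx
  · rw [if_neg h] at hx
    exact (Submodule.mem_bot K).1 hx ▸ rfl

lemma proj_mul {l : MvPolynomial (Fin n) K} (hl : l.IsHomogeneous 1)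
    (a : MvPolynomial (Fin n) K) (e : ℤ) : proj e (a * l) = proj (e - 1) a * l := by
  rw [proj, proj]
  split_ifs with h h' h'
  · rw [homogeneousComponent_mul_of_isHomogeneous hl, if_pos (by omega)]
    congr 3
    omega
  · rw [homogeneousComponent_mul_of_isHomogeneous hl, if_neg (by omega)]
    simp
  · omega
  · simp

lemma _root_.IsHomog.proj_mem {I : Ideal (MvPolynomial (Fin n) K)} (hI : IsHomog I) (e : ℤ)
    {x : MvPolynomial (Fin n) K} (hx : x ∈ I) : proj e x ∈ I := by
  rw [proj]
  split_ifs
  · exact hI x hx _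
  · exact I.zero_mem

lemma mul_mem_gr {l : MvPolynomial (Fin n) K} (hl : l.IsHomogeneous 1)
    {a : MvPolynomial (Fin n) K} {e : ℤ} (ha : a ∈ gr K n (e - 1)) : a * l ∈ gr K n e := by
  rw [← proj_of_mem ha, ← proj_mul hl]
  exact CappedLex.proj_mem _ _

/-- The Hilbert function of the quotient by `I`, in integer degrees. -/
noncomputable def hq (I : Ideal (MvPolynomial (Fin n) K)) (e : ℤ) : ℕ :=
  Module.finrank K (gr K n e) - Module.finrank K ↥(I.restrictScalars K ⊓ gr K n e)

lemma finrank_inf_gr_le (I : Ideal (MvPolynomial (Fin n) K)) (e : ℤ) :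
    Module.finrank K ↥(I.restrictScalars K ⊓ gr K n e) ≤ Module.finrank K (gr K n e) :=
  Submodule.finrank_mono inf_le_right

lemma hq_anti {I J : Ideal (MvPolynomial (Fin n) K)} (h : I ≤ J) (e : ℤ) : hq J e ≤ hq I e := by
  refine Nat.sub_le_sub_left (Submodule.finrank_mono ?_) _
  exact inf_le_inf_right _ h

lemma hq_eq_zero {I : Ideal (MvPolynomial (Fin n) K)} {e : ℤ}
    (h : gr K n e ≤ I.restrictScalars K) : hq I e = 0 := by
  rw [hq, inf_eq_right.2 h, Nat.sub_self]

/-- The colon ideal `I : l`. -/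
noncomputable def colonBy (I : Ideal (MvPolynomial (Fin n) K)) (l : MvPolynomial (Fin n) K) :
    Ideal (MvPolynomial (Fin n) K) :=
  Submodule.comap (LinearMap.mulRight (MvPolynomial (Fin n) K) l) I

lemma mem_colonBy {I : Ideal (MvPolynomial (Fin n) K)} {l x : MvPolynomial (Fin n) K} :
    x ∈ colonBy I l ↔ x * l ∈ I := Iff.rfl

lemma le_colonBy (I : Ideal (MvPolynomial (Fin n) K)) (l : MvPolynomial (Fin n) K) :
    I ≤ colonBy I l := fun _ hx => mem_colonBy.2 (I.mul_mem_right _ hx)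

lemma isHomog_colonBy {I : Ideal (MvPolynomial (Fin n) K)} (hI : IsHomog I)
    {l : MvPolynomial (Fin n) K} (hl : l.IsHomogeneous 1) : IsHomog (colonBy I l) := by
  intro x hx d
  have := hI _ (mem_colonBy.1 hx) (d + 1)
  rwa [homogeneousComponent_mul_of_isHomogeneous hl, if_pos (by omega), Nat.add_sub_cancel] at this

lemma isHomog_sup {I J : Ideal (MvPolynomial (Fin n) K)} (hI : IsHomog I) (hJ : IsHomog J) :
    IsHomog (I ⊔ J) := by
  intro x hx d
  obtain ⟨y, hy, z, hz, rfl⟩ := Submodule.mem_sup.1 hx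
  rw [map_add]
  exact Submodule.add_mem_sup (hI y hy d) (hJ z hz d)

lemma isHomog_span_singleton {l : MvPolynomial (Fin n) K} {k : ℕ} (hl : l.IsHomogeneous k) :
    IsHomog (Ideal.span {l}) :=
  isHomog_span fun _ hp => ⟨k, Set.mem_singleton_iff.1 hp ▸ hl⟩

lemma hq_eq_colonBy_add {I : Ideal (MvPolynomial (Fin n) K)} (hI : IsHomog I)
    {l : MvPolynomial (Fin n) K} (hl : l.IsHomogeneous 1) (hl0 : l ≠ 0) (e : ℤ) :
    hq I e = hq (colonBy I l) (e - 1) + hq (I ⊔ Ideal.span {l}) e := by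
  set φ : MvPolynomial (Fin n) K →ₗ[K] MvPolynomial (Fin n) K := LinearMap.mulRight K l with hφ
  have hφi : Function.Injective φ := mul_left_injective₀ hl0
  have hsup : (I.restrictScalars K ⊓ gr K n e) ⊔ (gr K n (e - 1)).map φ =
      (I ⊔ Ideal.span {l}).restrictScalars K ⊓ gr K n e := by
    refine le_antisymm
      (sup_le (inf_le_inf_right _ ((Submodule.restrictScalars_le K).2 le_sup_left)) ?_) ?_
    · rintro _ ⟨a, ha, rfl⟩
      exact ⟨Ideal.mem_sup_right (Ideal.mul_mem_left _ _ (Ideal.mem_span_singleton_self l)),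
        mul_mem_gr hl ha⟩
    · rintro x ⟨hxI, hx⟩
      obtain ⟨y, hy, z, hz, rfl⟩ := Submodule.mem_sup.1 hxI
      obtain ⟨b, rfl⟩ := Ideal.mem_span_singleton'.1 hz
      rw [← proj_of_mem hx, map_add, proj_mul hl]
      exact Submodule.add_mem_sup ⟨hI.proj_mem e hy, CappedLex.proj_mem _ _⟩
        (Submodule.mem_map_of_mem (f := φ) (CappedLex.proj_mem _ _))
  have hinf : (I.restrictScalars K ⊓ gr K n e) ⊓ (gr K n (e - 1)).map φ =
      ((colonBy I l).restrictScalars K ⊓ gr K n (e - 1)).map φ := by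
    ext x
    constructor
    · rintro ⟨⟨hxI, -⟩, ⟨a, ha, rfl⟩⟩
      exact ⟨a, ⟨hxI, ha⟩, rfl⟩
    · rintro ⟨a, ⟨haI, ha⟩, rfl⟩
      exact ⟨⟨haI, mul_mem_gr hl ha⟩, ⟨a, ha, rfl⟩⟩
  have : FiniteDimensional K ↥(I.restrictScalars K ⊓ gr K n e) :=
    Submodule.finiteDimensional_of_le inf_le_right
  have key := Submodule.finrank_sup_add_finrank_inf_eq (I.restrictScalars K ⊓ gr K n e)
    ((gr K n (e - 1)).map φ)
  rw [hsup, hinf, (Submodule.equivMapOfInjective φ hφi _).symm.finrank_eq,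
    (Submodule.equivMapOfInjective φ hφi _).symm.finrank_eq] at key
  have h₁ := finrank_inf_gr_le I e
  have h₂ := finrank_inf_gr_le (colonBy I l) (e - 1)
  have h₃ := finrank_inf_gr_le (I ⊔ Ideal.span {l}) e
  unfold hq
  omega

end Hilbert

section Macaulay

/-- `h` grows at least as fast as lower shadows of initial segments allow. -/
def GoodH {m : ℕ} (c : Fin m → ℕ) (h : ℤ → ℕ) : Prop :=
  ∀ e, h e ≤ #(box c e) ∧ ∀ D, IsInit c (e + 1) D → #D = h (e + 1) → #(shadow D) ≤ h e

lemma goodH_zero {m : ℕ} (c : Fin m → ℕ) : GoodH c 0 := fun e =>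
  ⟨Nat.zero_le _, fun D _ hD => by simp [card_eq_zero.1 hD]⟩

lemma goodH_of_slices {m : ℕ} {c : Fin (m + 1) → ℕ} (hc : Monotone c) {h : ℤ → ℕ}
    (hh : ∀ d : ℤ, ∃ H : ℕ → ℤ → ℕ, (∀ j, GoodH (c ∘ Fin.succ) (H j)) ∧
      (∀ e, h e = ∑ j ∈ range (c 0), H j (e - j)) ∧
      ∀ j : ℕ, H (j + 1) (d - j) ≤ H j (d - j)) : GoodH c h := by
  have hsucc : c ∘ Fin.succAbove 0 = c ∘ Fin.succ := by rw [Fin.succAbove_zero]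
  intro e
  obtain ⟨H, hH, hsum, hle⟩ := hh e
  refine ⟨?_, fun D hD hDcard => ?_⟩
  · rw [hsum, card_eq_sum_slice (Subset.refl _) 0]
    refine sum_le_sum fun j hj => ?_
    rw [slice_box (mem_range.1 hj), hsucc]
    exact (hH j _).1
  · have hex (j : ℕ) : ∃ E, IsInit (c ∘ Fin.succAbove 0) (e + 1 - j) E ∧ #E = H j (e + 1 - j) := by
      rw [hsucc]
      exact exists_isInit _ _ (hH j _).1
    choose E hE hEcard using hex
    have hEb : ∀ j, E j ⊆ box (c ∘ Fin.succAbove 0) (e + 1 - j) := fun j => (hE j).1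
    refine (shadowMinimal_of_monotone hc _ _ _ (assemble_subset_box hEb) hD ?_).trans ?_
    · rw [hDcard, hsum, card_assemble hEb]
      exact sum_congr rfl fun j _ => (hEcard j).symm
    · rw [hsum e]
      have hshift (j : ℕ) : e + 1 - (j : ℤ) = e - j + 1 := by ring
      refine card_shadow_assemble_le hE (fun j => ?_) fun j => ?_
      · refine (hH j _).2 (E j) ?_ ?_
        · rw [← hshift, ← hsucc]
          exact hE j
        · rw [← hshift]
          exact hEcard j
      · have h1 := hle j
        have h2 := hEcard (j + 1)
        have h3 : e + 1 - ((j + 1 : ℕ) : ℤ) = e - j := by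
          push_cast
          ring
        rw [h3] at h2
        exact h2.trans_le h1

variable {K : Type*} [Field K] {n : ℕ}

/-- Peeling off linear factors greedily, by the size in degree `d`. -/
lemma exists_slices {m : ℕ} {c : Fin m → ℕ} (s : Multiset (MvPolynomial (Fin n) K)) (d : ℤ)
    {I : Ideal (MvPolynomial (Fin n) K)} (hI : IsHomog I)
    (hs : ∀ l ∈ s, l.IsHomogeneous 1 ∧ l ≠ 0) (hsI : s.prod ∈ I)
    (hgood : ∀ J, I ≤ J → IsHomog J → ∀ l ∈ s, GoodH c (hq (J ⊔ Ideal.span {l}))) :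
    ∃ H : ℕ → ℤ → ℕ, (∀ j, GoodH c (H j)) ∧
      (∀ e, hq I e = ∑ j ∈ range (Multiset.card s), H j (e - j)) ∧
      (∀ j : ℕ, H (j + 1) (d - j) ≤ H j (d - j)) ∧
      (H 0 = 0 ∨ ∃ l ∈ s, H 0 = hq (I ⊔ Ideal.span {l})) := by
  classical
  induction hk : Multiset.card s generalizing s d I with
  | zero =>
    rw [Multiset.card_eq_zero.1 hk, Multiset.prod_zero, ← Ideal.eq_top_iff_one] at hsI
    refine ⟨fun _ => 0, fun _ => goodH_zero c, fun e => ?_, fun _ => le_rfl, Or.inl rfl⟩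
    rw [hq_eq_zero (by rw [hsI]; exact le_top)]
    simp
  | succ k ih =>
    have hne : s.toFinset.Nonempty := by
      rw [Multiset.toFinset_nonempty]
      rintro rfl
      simp at hk
    obtain ⟨l, hl, hmax⟩ := exists_max_image s.toFinset (fun l => hq (I ⊔ Ideal.span {l}) d) hne
    simp only [Multiset.mem_toFinset] at hl hmax
    have hll := hs l hl
    obtain ⟨H, hH, hsum, hle, hfirst⟩ := ih (s.erase l) (d - 1) (isHomog_colonBy hI hll.1)
      (fun l' hl' => hs l' (Multiset.mem_of_mem_erase hl'))
      (by rw [mem_colonBy, mul_comm, Multiset.prod_erase hl]; exact hsI)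
      (fun J hJ hJh l' hl' => hgood J ((le_colonBy I l).trans hJ) hJh l'
        (Multiset.mem_of_mem_erase hl'))
      (by rw [Multiset.card_erase_of_mem hl, hk]; rfl)
    refine ⟨fun j => Nat.casesOn j (hq (I ⊔ Ideal.span {l})) H, fun j => ?_, fun e => ?_,
      fun j => ?_, Or.inr ⟨l, hl, rfl⟩⟩
    · cases j with
      | zero => exact hgood I le_rfl hI l hl
      | succ j => exact hH j
    · rw [sum_range_succ', hq_eq_colonBy_add hI hll.1 hll.2, hsum]
      congr 1
      · refine sum_congr rfl fun j _ => ?_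
        dsimp only
        congr 1
        push_cast
        ring
      · simp
    · cases j with
      | zero =>
        simp only [Nat.cast_zero, sub_zero]
        rcases hfirst with h0 | ⟨l', hl', h0⟩
        · rw [h0]
          exact Nat.zero_le _
        · rw [h0]
          exact (hq_anti (sup_le_sup_right (le_colonBy I l) _) d).trans
            (hmax l' (Multiset.mem_of_mem_erase hl'))
      | succ j =>
        have := hle j
        rw [show d - 1 - (j : ℤ) = d - ((j + 1 : ℕ) : ℤ) by push_cast; ring] at this
        exact this

/-- `I` contains products of `c i` linear forms avoiding any given space of linear forms that
contains `W` and has dimension at most `dim W + i`. -/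
def AvoidingProducts {m : ℕ} (c : Fin m → ℕ) (W : Submodule K (MvPolynomial (Fin n) K))
    (I : Ideal (MvPolynomial (Fin n) K)) : Prop :=
  ∀ i : Fin m, ∀ U : Submodule K (MvPolynomial (Fin n) K), W ≤ U →
    U ≤ homogeneousSubmodule (Fin n) K 1 → Module.finrank K U ≤ Module.finrank K W + i →
    ∃ s : Multiset (MvPolynomial (Fin n) K), Multiset.card s = c i ∧
      (∀ l ∈ s, l.IsHomogeneous 1 ∧ l ∉ U) ∧ s.prod ∈ I

instance (e : ℕ) : FiniteDimensional K (homogeneousSubmodule (Fin n) K e) :=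
  Module.Finite.of_fg (homogeneousSubmodule_fg _ _ _)

lemma finrank_homogeneousSubmodule_one :
    Module.finrank K (homogeneousSubmodule (Fin n) K 1) = n := by
  rw [homogeneousSubmodule_one_eq_span_X,
    finrank_span_eq_card (MvPolynomial.linearIndependent_X (Fin n) K),
    Fintype.card_fin]

lemma goodH_of_linear_le {c : Fin 0 → ℕ} {I : Ideal (MvPolynomial (Fin n) K)}
    (hI : ∀ i, (X i : MvPolynomial (Fin n) K) ∈ I) : GoodH c (hq I) := by
  intro e
  refine ⟨?_, fun D _ _ => ?_⟩
  · rcases lt_trichotomy e 0 with he | rfl | he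
    · rw [hq_eq_zero]
      · exact Nat.zero_le _
      · rw [gr, if_neg (by omega)]
        exact bot_le
    · have h1 : #(box c 0) = 1 := by simp [box]
      rw [h1]
      refine (Nat.sub_le _ _).trans ?_
      rw [gr, if_pos le_rfl, Int.toNat_zero, homogeneousSubmodule_zero]
      rw [Submodule.one_eq_span]
      exact (finrank_span_le_card _).trans (by simp)
    · rw [hq_eq_zero]
      · exact Nat.zero_le _
      · intro x hx
        rw [gr, if_pos he.le, mem_homogeneousSubmodule] at hx
        have hx' : x ∈ Ideal.span (X '' (Set.univ : Set (Fin n))) := by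
          rw [mem_ideal_span_X_image]
          intro m hm
          by_contra! h
          have := hx.degree_eq_sum_deg_support hm
          have hm0 : m = 0 := Finsupp.ext fun i => h i (Set.mem_univ i)
          rw [hm0] at this
          simp at this
          omega
        refine Ideal.span_le.2 ?_ hx'
        rintro _ ⟨i, -, rfl⟩
        exact hI i
  · have : shadow D = ∅ := eq_empty_of_forall_notMem fun w hw => (mem_shadow.1 hw).choose.elim0
    simp [this]

theorem goodH_hq {m : ℕ} {c : Fin m → ℕ} (hc : Monotone c)
    {W : Submodule K (MvPolynomial (Fin n) K)} {I : Ideal (MvPolynomial (Fin n) K)}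
    (hW1 : W ≤ homogeneousSubmodule (Fin n) K 1) (hWn : Module.finrank K W + m = n)
    (hWI : W ≤ I.restrictScalars K) (hI : IsHomog I) (h : AvoidingProducts c W I) :
    GoodH c (hq I) := by
  induction m generalizing W I with
  | zero =>
    have hWtop := Submodule.eq_of_le_of_finrank_eq hW1
      (by rw [finrank_homogeneousSubmodule_one]; exact hWn)
    refine goodH_of_linear_le fun i => hWI ?_
    rw [hWtop]
    exact isHomogeneous_X _ _
  | succ m ih =>
    have hWfin : FiniteDimensional K W := Submodule.finiteDimensional_of_le hW1
    obtain ⟨s, hs, hsW, hsI⟩ := h 0 W le_rfl hW1 (by simp)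
    have hgood : ∀ J, I ≤ J → IsHomog J → ∀ l ∈ s,
        GoodH (c ∘ Fin.succ) (hq (J ⊔ Ideal.span {l})) := by
      intro J hIJ hJ l hl
      obtain ⟨hl1, hlW⟩ := hsW l hl
      have hspan : K ∙ l ≤ homogeneousSubmodule (Fin n) K 1 := by
        rw [Submodule.span_singleton_le_iff_mem]
        exact hl1
      have hrank : Module.finrank K ↥(W ⊔ K ∙ l) = Module.finrank K W + 1 := by
        have hl0 : l ≠ 0 := fun h0 => hlW (h0 ▸ W.zero_mem)
        have := Submodule.finrank_sup_add_finrank_inf_eq W (K ∙ l)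
        rwa [((Submodule.disjoint_span_singleton' hl0).2 hlW).eq_bot, finrank_bot, add_zero,
          finrank_span_singleton hl0] at this
      refine ih (W := W ⊔ K ∙ l) (hc.comp Fin.strictMono_succ.monotone) (sup_le hW1 hspan)
        (by omega)
        (sup_le ?_ ?_) (isHomog_sup hJ (isHomog_span_singleton hl1)) ?_
      · exact hWI.trans ((Submodule.restrictScalars_le K).2 (hIJ.trans le_sup_left))
      · rw [Submodule.span_singleton_le_iff_mem]
        exact Ideal.mem_sup_right (Ideal.mem_span_singleton_self l)
      · intro i U hU hU1 hUr
        obtain ⟨t, ht, htU, htI⟩ := h i.succ U (le_sup_left.trans hU) hU1 (by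
          rw [Fin.val_succ]; omega)
        exact ⟨t, ht, htU, (hIJ.trans le_sup_left) htI⟩
    refine goodH_of_slices hc fun d => ?_
    obtain ⟨H, hH, hsum, hle, -⟩ := exists_slices (c := c ∘ Fin.succ) s d hI
      (fun l hl => ⟨(hsW l hl).1, fun h0 => (hsW l hl).2 (h0 ▸ W.zero_mem)⟩) hsI hgood
    exact ⟨H, hH, hs ▸ hsum, hle⟩

end Macaulay

section RegularSequence

variable {K : Type*} [Field K] {n r : ℕ}

lemma le_height_of_isRegSeq {f : Fin r → MvPolynomial (Fin n) K} (hf : IsRegSeq f) {k : ℕ}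
    (hk : k ≤ r) (Q : Ideal (MvPolynomial (Fin n) K)) [Q.IsPrime]
    (hQ : ∀ j : Fin r, j < k → f j ∈ Q) : (k : ℕ∞) ≤ Q.height := by
  induction k generalizing Q with
  | zero => simp
  | succ k ih =>
    set I := Ideal.span {p | ∃ j : Fin r, j < (⟨k, hk⟩ : Fin r) ∧ p = f j} with hI
    have hIQ : I ≤ Q := Ideal.span_le.2 <| by
      rintro _ ⟨j, hj, rfl⟩
      exact hQ j (Nat.lt_succ_of_lt (Fin.lt_def.1 hj))
    obtain ⟨p, hp, hpQ⟩ := Ideal.exists_minimalPrimes_le hIQ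
    have := hp.isPrime
    have hlt : p < Q := by
      refine lt_of_le_of_ne hpQ ?_
      rintro rfl
      obtain ⟨y, hy, hmul⟩ :=
        Ideal.exists_mul_mem_of_mem_minimalPrimes hp (hQ ⟨k, hk⟩ (Nat.lt_succ_self k))
      rw [mul_comm] at hmul
      exact hy (hf _ y hmul)
    have h₁ := ih (Nat.le_of_succ_le hk) p fun j hj =>
      hp.le (Ideal.subset_span ⟨j, Fin.lt_def.2 hj, rfl⟩)
    push_cast
    exact (add_le_add_left h₁ 1).trans (Ideal.height_add_one_le_of_lt_of_isPrime hlt)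

lemma exists_prime_of_le_linear {U : Submodule K (MvPolynomial (Fin n) K)}
    (hU : U ≤ homogeneousSubmodule (Fin n) K 1) :
    ∃ Q : Ideal (MvPolynomial (Fin n) K), Q.IsPrime ∧ Ideal.span (U : Set _) ≤ Q ∧
      Q.height ≤ Module.finrank K U := by
  have hfin : FiniteDimensional K U := Submodule.finiteDimensional_of_le hU
  have htop : Ideal.span (U : Set (MvPolynomial (Fin n) K)) ≠ ⊤ := by
    intro h
    have hle : Ideal.span (U : Set (MvPolynomial (Fin n) K)) ≤
        RingHom.ker (constantCoeff (R := K) (σ := Fin n)) := Ideal.span_le.2 fun x hx =>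
      (hU hx : x.IsHomogeneous 1).coeff_eq_zero (by simp)
    rw [h, top_le_iff] at hle
    exact RingHom.ker_ne_top _ hle
  set b := Module.finBasis K U
  set S : Set (MvPolynomial (Fin n) K) := Set.range fun i => (b i : MvPolynomial (Fin n) K)
  have hS : Ideal.span (U : Set (MvPolynomial (Fin n) K)) = Ideal.span S := by
    refine le_antisymm (Ideal.span_le.2 fun x hx => ?_) (Ideal.span_mono ?_)
    · have hmem : x ∈ Submodule.span K S := by
        have h := congrArg (Submodule.map U.subtype) b.span_eq
        rw [Submodule.map_span, ← Set.range_comp, Submodule.map_subtype_top] at h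
        exact h ▸ hx
      exact Submodule.span_le_restrictScalars K _ S hmem
    · rintro _ ⟨i, rfl⟩
      exact (b i).2
  obtain ⟨Q, hQ⟩ := Ideal.nonempty_minimalPrimes htop
  refine ⟨Q, hQ.isPrime, hQ.le, ?_⟩
  rw [hS] at hQ
  refine (Ideal.height_le_card_of_mem_minimalPrimes_span (Set.finite_range _) hQ).trans ?_
  have := Set.ncard_image_le (f := fun i => (b i : MvPolynomial (Fin n) K)) Set.finite_univ
  rw [Set.image_univ, Set.ncard_univ, Nat.card_eq_fintype_card, Fintype.card_fin] at this
  exact_mod_cast this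

lemma exists_X_notMem {U : Submodule K (MvPolynomial (Fin n) K)}
    (hU : U ≤ homogeneousSubmodule (Fin n) K 1) (hUn : Module.finrank K U < n) :
    ∃ j, (X j : MvPolynomial (Fin n) K) ∉ U := by
  by_contra! h
  have hfin : FiniteDimensional K U := Submodule.finiteDimensional_of_le hU
  have hle : homogeneousSubmodule (Fin n) K 1 ≤ U := by
    rw [homogeneousSubmodule_one_eq_span_X, Submodule.span_le]
    rintro _ ⟨j, rfl⟩
    exact h j
  have := Submodule.finrank_mono hle
  rw [finrank_homogeneousSubmodule_one] at this
  omega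

lemma exists_prod_mem {a : Fin r → ℕ} (hrn : r ≤ n) (hmono : Monotone a)
    {f : Fin r → MvPolynomial (Fin n) K} (hreg : IsRegSeq f)
    (hdeg : ∀ i, (f i).IsHomogeneous (a i)) {G : Set (MvPolynomial (Fin n) K)}
    (hlin : ∀ p ∈ G, ∃ (k : ℕ) (l : Fin k → MvPolynomial (Fin n) K),
      (∀ t, (l t).IsHomogeneous 1) ∧ p = ∏ t, l t)
    (hfG : ∀ i, f i ∈ Ideal.span G) (i : Fin r) {U : Submodule K (MvPolynomial (Fin n) K)}
    (hU : U ≤ homogeneousSubmodule (Fin n) K 1) (hUi : Module.finrank K U ≤ i) :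
    ∃ s : Multiset (MvPolynomial (Fin n) K), Multiset.card s = a i ∧
      (∀ l ∈ s, l.IsHomogeneous 1 ∧ l ∉ U) ∧ s.prod ∈ Ideal.span G := by
  obtain ⟨Q, hQ, hUQ, hht⟩ := exists_prime_of_le_linear hU
  obtain ⟨p, hp, k, l, hl, hpl, hki, hpQ⟩ : ∃ p ∈ G, ∃ (k : ℕ) (l : Fin k → _),
      (∀ t, (l t).IsHomogeneous 1) ∧ p = ∏ t, l t ∧ k ≤ a i ∧ p ∉ Q := by
    by_contra! h
    have hfQ : ∀ j : Fin r, (j : ℕ) < i + 1 → f j ∈ Q := fun j hj => by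
      rw [← homogeneousComponent_eq_self (hdeg j)]
      refine homogeneousComponent_mem_of_mem_span (fun p hp => ?_) (hfG j)
      obtain ⟨k, l, hl, hpl⟩ := hlin p hp
      refine ⟨k, ?_, fun hk => h p hp k l hl hpl (hk.trans (hmono (Fin.le_def.2 (by omega))))⟩
      rw [hpl]
      simpa using IsHomogeneous.prod univ l (fun _ => 1) fun t _ => hl t
    have := (le_height_of_isRegSeq hreg i.2 Q hfQ).trans
      (hht.trans (Nat.cast_le.2 hUi))
    have : (i : ℕ) + 1 ≤ i := by exact_mod_cast this
    omega
  obtain ⟨j, hj⟩ := exists_X_notMem hU (by omega)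
  refine ⟨univ.val.map l + Multiset.replicate (a i - k) (X j), ?_, fun q hq => ?_, ?_⟩
  · simp
    omega
  · rcases Multiset.mem_add.1 hq with hq | hq
    · obtain ⟨t, -, rfl⟩ := Multiset.mem_map.1 hq
      refine ⟨hl t, fun hlU => hpQ ?_⟩
      rw [hpl, ← mul_prod_erase _ _ (mem_univ t)]
      exact Q.mul_mem_right _ (hUQ (Ideal.subset_span hlU))
    · rw [Multiset.eq_of_mem_replicate hq]
      exact ⟨isHomogeneous_X _ _, hj⟩
  · rw [Multiset.prod_add]
    refine Ideal.mul_mem_right _ _ (Ideal.subset_span ?_)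
    rwa [prod_map_val, ← hpl]

end RegularSequence

section Truncation

variable {K : Type*} [Field K] {n r : ℕ}

/-- The caps of the degree sequence `a`, continued by the constant `N`. -/
def caps (n : ℕ) {r : ℕ} (a : Fin r → ℕ) (N : ℕ) (i : Fin n) : ℕ :=
  if h : (i : ℕ) < r then a ⟨i, h⟩ else N

lemma caps_castLE (hrn : r ≤ n) (a : Fin r → ℕ) (N : ℕ) (i : Fin r) :
    caps n a N (Fin.castLE hrn i) = a i := by
  simp [caps]

lemma monotone_caps {a : Fin r → ℕ} (ha : Monotone a) {N : ℕ} (hN : ∀ i, a i ≤ N) :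
    Monotone (caps n a N) := by
  intro i j hij
  unfold caps
  split_ifs with hi hj hj
  · exact ha (Fin.le_def.2 (Fin.le_def.1 hij))
  · exact hN _
  · exact absurd (lt_of_le_of_lt (Fin.le_def.1 hij) hj) hi
  · exact le_rfl

/-- The ideal generated by the `N`-th powers of all variables. -/
noncomputable def powersIdeal (K : Type*) [Field K] (n N : ℕ) :
    Ideal (MvPolynomial (Fin n) K) :=
  Ideal.span (Set.range fun i => X i ^ N)

lemma isHomogeneous_of_mem_range_pow {N : ℕ} {p : MvPolynomial (Fin n) K}
    (hp : p ∈ Set.range fun i : Fin n => (X i : MvPolynomial (Fin n) K) ^ N) :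
    p.IsHomogeneous N := by
  obtain ⟨i, rfl⟩ := hp
  exact isHomogeneous_X_pow i N

lemma hq_sup_powersIdeal {I : Ideal (MvPolynomial (Fin n) K)} (hI : IsHomog I) {N e : ℕ}
    (he : e < N) : hq (I ⊔ powersIdeal K n N) e = hq I e := by
  suffices h : (I ⊔ powersIdeal K n N).restrictScalars K ⊓ gr K n e =
      I.restrictScalars K ⊓ gr K n e by rw [hq, hq, h]
  refine le_antisymm ?_ (inf_le_inf_right _ ((Submodule.restrictScalars_le K).2 le_sup_left))
  rintro x ⟨hxI, hx⟩
  refine ⟨?_, hx⟩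
  rw [SetLike.mem_coe, gr_natCast] at hx
  obtain ⟨y, hy, z, hz, hyz⟩ := Submodule.mem_sup.1 hxI
  have hz0 : homogeneousComponent e z ∈ (⊥ : Ideal (MvPolynomial (Fin n) K)) :=
    homogeneousComponent_mem_of_mem_span
      (fun p hp => ⟨N, isHomogeneous_of_mem_range_pow hp, fun h => by omega⟩) hz
  rw [Ideal.mem_bot] at hz0
  change x ∈ I
  rw [← homogeneousComponent_eq_self hx, ← hyz, map_add, hz0, add_zero]
  exact hI y hy e

lemma goodH_sup_powersIdeal {a : Fin r → ℕ} (hrn : r ≤ n) (hmono : Monotone a)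
    {f : Fin r → MvPolynomial (Fin n) K} (hreg : IsRegSeq f)
    (hdeg : ∀ i, (f i).IsHomogeneous (a i)) {G : Set (MvPolynomial (Fin n) K)}
    (hlin : ∀ p ∈ G, ∃ (k : ℕ) (l : Fin k → MvPolynomial (Fin n) K),
      (∀ t, (l t).IsHomogeneous 1) ∧ p = ∏ t, l t)
    (hfG : ∀ i, f i ∈ Ideal.span G) {I : Ideal (MvPolynomial (Fin n) K)} (hI : IsHomog I)
    (hGI : Ideal.span G ≤ I) {N : ℕ} (hN : ∀ i, a i ≤ N) :
    GoodH (caps n a N) (hq (I ⊔ powersIdeal K n N)) := by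
  refine goodH_hq (W := ⊥) (monotone_caps hmono hN) bot_le (by simp) bot_le
    (isHomog_sup hI (isHomog_span fun p hp => ⟨N, isHomogeneous_of_mem_range_pow hp⟩)) ?_
  intro i U _ hU hUi
  rw [finrank_bot, zero_add] at hUi
  by_cases hir : (i : ℕ) < r
  · obtain ⟨s, hs, hsU, hsG⟩ := exists_prod_mem hrn hmono hreg hdeg hlin hfG ⟨i, hir⟩ hU hUi
    exact ⟨s, by simp [caps, hir, hs], hsU, Ideal.mem_sup_left (hGI hsG)⟩
  · obtain ⟨j, hj⟩ := exists_X_notMem hU (hUi.trans_lt i.2)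
    refine ⟨Multiset.replicate N (X j), by simp [caps, hir], fun l hl => ?_, ?_⟩
    · rw [Multiset.eq_of_mem_replicate hl]
      exact ⟨isHomogeneous_X _ _, hj⟩
    · rw [Multiset.prod_replicate]
      exact Ideal.mem_sup_right (Ideal.subset_span ⟨j, rfl⟩)

end Truncation

section Monomial

variable {K : Type*} [Field K] {n r : ℕ}

lemma expDeg_eq_degree (m : Fin n →₀ ℕ) : expDeg m = m.degree :=
  (Finsupp.degree_eq_sum m).symm

lemma finite_setOf_expDeg_eq (n e : ℕ) : {m : Fin n →₀ ℕ | expDeg m = e}.Finite := by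
  refine Set.Finite.subset (Set.Finite.preimage DFunLike.coe_injective.injOn
    (box (fun _ : Fin n => e + 1) (e : ℤ)).finite_toSet) fun m hm => ?_
  have hm' : ∑ i, m i = e := hm
  refine mem_box.2 ⟨fun i => Nat.lt_succ_of_le ?_, by exact_mod_cast hm⟩
  rw [← hm']
  exact single_le_sum (f := fun i => m i) (fun _ _ => Nat.zero_le _) (mem_univ i)

lemma eq_of_le_of_expDeg_eq {m m' : Fin n →₀ ℕ} (h : m ≤ m') (hd : expDeg m = expDeg m') :
    m = m' :=
  Finsupp.ext fun i => (sum_eq_sum_iff_of_le fun i _ => h i).1 hd i (mem_univ i)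

lemma expDeg_mono {m m' : Fin n →₀ ℕ} (h : m ≤ m') : expDeg m ≤ expDeg m' :=
  sum_le_sum fun i _ => h i

lemma exists_add_single_of_le {m m' : Fin n →₀ ℕ} (h : m ≤ m')
    (hd : expDeg m' = expDeg m + 1) : ∃ j, m + Finsupp.single j 1 = m' := by
  obtain ⟨j, -, hj⟩ := exists_lt_of_sum_lt (s := univ) (f := fun i => m i) (g := fun i => m' i)
    (show expDeg m < expDeg m' by omega)
  refine ⟨j, eq_of_le_of_expDeg_eq (fun k => ?_) ?_⟩
  · rcases eq_or_ne k j with rfl | hk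
    · simpa using hj
    · simpa [hk, Finsupp.single_apply, hk.symm] using h k
  · rw [hd]
    simp [expDeg, sum_add_distrib, Finsupp.single_apply]

lemma homogeneousSubmodule_eq_restrictSupport (e : ℕ) :
    homogeneousSubmodule (Fin n) K e = restrictSupport K {m | expDeg m = e} := by
  rw [homogeneousSubmodule_eq_finsupp_supported]
  simp only [expDeg_eq_degree]
  rfl

lemma component_eq_restrictSupport {J : Ideal (MvPolynomial (Fin n) K)} {U : Set (Fin n →₀ ℕ)}
    (hJ : J.restrictScalars K = restrictSupport K U) (e : ℕ) :
    component J e = restrictSupport K (U ∩ {m | expDeg m = e}) := by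
  ext x
  rw [component, hJ, homogeneousSubmodule_eq_restrictSupport, Submodule.mem_inf]
  simp only [mem_restrictSupport_iff, Set.subset_inter_iff]

lemma restrictScalars_purePowers (hrn : r ≤ n) (a : Fin r → ℕ) :
    (purePowers K hrn a).restrictScalars K =
      restrictSupport K {m | ∃ i, a i ≤ m (Fin.castLE hrn i)} := by
  ext x
  rw [Submodule.restrictScalars_mem, mem_restrictSupport_iff, purePowers]
  have : (Set.range fun i : Fin r => (X (Fin.castLE hrn i) : MvPolynomial (Fin n) K) ^ a i) =
      (fun s => monomial s 1) ''
        Set.range fun i : Fin r => Finsupp.single (Fin.castLE hrn i) (a i) := by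
    rw [← Set.range_comp]
    simp [Function.comp_def, X_pow_eq_monomial]
  rw [this, mem_ideal_span_monomial_image]
  simp [Set.subset_def]

lemma span_monomial_sup_restrictSupport (S T : Set (Fin n →₀ ℕ)) :
    Submodule.span K ((fun m => (monomial m (1 : K) : MvPolynomial (Fin n) K)) '' S) ⊔
      restrictSupport K T = restrictSupport K (S ∪ T) := by
  rw [restrictSupport_eq_span, restrictSupport_eq_span, Set.image_union, Submodule.span_union]

lemma finrank_restrictSupport (S : Set (Fin n →₀ ℕ)) :
    Module.finrank K (restrictSupport K S) = S.ncard := by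
  rw [Module.finrank_eq_nat_card_basis (basisRestrictSupport K S), Nat.card_coe_set_eq]

lemma isHomog_of_restrictScalars_eq {J : Ideal (MvPolynomial (Fin n) K)}
    {U : Set (Fin n →₀ ℕ)} (hJ : J.restrictScalars K = restrictSupport K U) : IsHomog J := by
  intro x hx d
  have hmem (y) : y ∈ J ↔ (y.support : Set (Fin n →₀ ℕ)) ⊆ U := by
    rw [← Submodule.restrictScalars_mem K, hJ, mem_restrictSupport_iff]
  rw [hmem] at hx ⊢
  rw [support_homogeneousComponent]
  exact fun m hm => hx (mem_filter.1 hm).1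

lemma hilb_add_card {J : Ideal (MvPolynomial (Fin n) K)}
    {U : Set (Fin n →₀ ℕ)} (hJ : J.restrictScalars K = restrictSupport K U) {e : ℕ}
    {D : Finset (Fin n → ℕ)} (hD : ∀ m : Fin n →₀ ℕ, ⇑m ∈ D ↔ expDeg m = e ∧ m ∉ U) :
    hilb J e + #D = Module.finrank K (homogeneousSubmodule (Fin n) K e) := by
  rw [hilb, component_eq_restrictSupport hJ, homogeneousSubmodule_eq_restrictSupport,
    finrank_restrictSupport, finrank_restrictSupport]
  have hDcard : #D = (DFunLike.coe ⁻¹' (D : Set (Fin n → ℕ)) : Set (Fin n →₀ ℕ)).ncard := by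
    rw [Set.ncard_preimage_of_injective_subset_range DFunLike.coe_injective, Set.ncard_coe_finset]
    exact fun w _ => ⟨Finsupp.equivFunOnFinite.symm w, rfl⟩
  have hset : (DFunLike.coe ⁻¹' (D : Set (Fin n → ℕ)) : Set (Fin n →₀ ℕ)) =
      {m | expDeg m = e} \ (U ∩ {m | expDeg m = e}) := by
    ext m
    simp only [Set.mem_preimage, SetLike.mem_coe, hD, Set.mem_sdiff, Set.mem_inter_iff,
      Set.mem_ofPred_eq]
    tauto
  rw [hDcard, hset, add_comm]
  exact Set.ncard_sdiff_add_ncard_of_subset Set.inter_subset_right (finite_setOf_expDeg_eq n e)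

lemma hilb_add_hq (I : Ideal (MvPolynomial (Fin n) K)) (e : ℕ) :
    hilb I e + hq I e = Module.finrank K (homogeneousSubmodule (Fin n) K e) := by
  have := finrank_inf_gr_le I e
  rw [hq, hilb, component]
  rw [gr_natCast] at this ⊢
  omega

end Monomial

section Assembly

variable {K : Type*} [Field K] {n r : ℕ}

lemma lexLe_iff {m m' : Fin n →₀ ℕ} : lexLe m m' ↔ m = m' ∨ toLex ⇑m < toLex ⇑m' := Iff.rfl

/-- A lex-plus-powers ideal with prescribed complement `E` in degrees `d` and `d + 1`. -/
lemma exists_isLPP (K : Type*) [Field K] (hrn : r ≤ n) {a : Fin r → ℕ} {N d : ℕ}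
    (hN : d + 1 < N) {D D' : Finset (Fin n → ℕ)} (hD : IsInit (caps n a N) (d : ℕ) D)
    (hD' : IsInit (caps n a N) (d + 1 : ℕ) D') (hDD' : shadow D' ⊆ D) :
    ∃ J : Ideal (MvPolynomial (Fin n) K), IsLPP hrn a J ∧
      hilb J d + #D = Module.finrank K (homogeneousSubmodule (Fin n) K d) ∧
      hilb J (d + 1) + #D' = Module.finrank K (homogeneousSubmodule (Fin n) K (d + 1)) := by
  set c := caps n a N with hc
  set P : Set (Fin n →₀ ℕ) := {m | ∃ i, a i ≤ m (Fin.castLE hrn i)} with hP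
  have hsum (m : Fin n →₀ ℕ) : ∑ i, m i = expDeg m := rfl
  have hDbox (m : Fin n →₀ ℕ) (hm : ⇑m ∈ D) : (∀ i, m i < c i) ∧ expDeg m = d := by
    have := mem_box.1 (hD.1 hm)
    exact ⟨this.1, by exact_mod_cast this.2⟩
  have hDbox' (m : Fin n →₀ ℕ) (hm : ⇑m ∈ D') : (∀ i, m i < c i) ∧ expDeg m = d + 1 := by
    have := mem_box.1 (hD'.1 hm)
    exact ⟨this.1, by exact_mod_cast this.2⟩
  have hcP (m : Fin n →₀ ℕ) (h : ∀ i, m i < c i) : m ∉ P := by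
    rintro ⟨i, hi⟩
    have := h (Fin.castLE hrn i)
    rw [hc, caps_castLE] at this
    omega
  have hPc (m : Fin n →₀ ℕ) (hm : m ∉ P) (he : expDeg m ≤ d + 1) (i : Fin n) : m i < c i := by
    rw [hc, caps]
    split_ifs with h
    · by_contra! hlt
      exact hm ⟨⟨i, h⟩, hlt⟩
    · have : m i ≤ ∑ i, m i := single_le_sum (f := fun i => m i) (fun _ _ => Nat.zero_le _)
        (mem_univ i)
      rw [hsum] at this
      omega
  set U : Set (Fin n →₀ ℕ) := {m | m ∈ P ∨ d ≤ expDeg m ∧ ⇑m ∉ D ∧ ⇑m ∉ D'} with hUdef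
  have hU : IsUpperSet U := by
    intro m m' hmm hm
    rcases hm with ⟨i, hi⟩ | ⟨hdm, hmD, hmD'⟩
    · exact Or.inl ⟨i, hi.trans (hmm _)⟩
    · have hle := expDeg_mono hmm
      refine Or.inr ⟨hdm.trans hle, fun h => ?_, fun h => ?_⟩
      · have := (hDbox m' h).2
        exact hmD (eq_of_le_of_expDeg_eq hmm (by omega) ▸ h)
      · have := (hDbox' m' h).2
        rcases hle.eq_or_lt with heq | hlt
        · exact hmD' (eq_of_le_of_expDeg_eq hmm heq ▸ h)
        · obtain ⟨j, rfl⟩ := exists_add_single_of_le hmm (by omega)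
          refine hmD (hDD' (mem_shadow.2 ⟨j, ?_⟩))
          rwa [Finsupp.coe_add, Finsupp.single_eq_pi_single] at h
  have hJ : (restrictSupportIdeal K U hU).restrictScalars K = restrictSupport K U := rfl
  refine ⟨restrictSupportIdeal K U hU, ⟨isHomog_of_restrictScalars_eq hJ, fun e => ?_⟩,
    hilb_add_card hJ fun m => ?_, hilb_add_card hJ fun m => ?_⟩
  · refine ⟨{m | expDeg m = e ∧ d ≤ e ∧ (e = d → ∀ w ∈ D, toLex w < toLex ⇑m) ∧
      (e = d + 1 → ∀ w ∈ D', toLex w < toLex ⇑m)}, ⟨fun m hm => hm.1, ?_⟩, ?_⟩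
    · rintro m ⟨-, hde, h, h'⟩ m' hm' hle
      rcases lexLe_iff.1 hle with rfl | hlt
      · exact ⟨hm', hde, h, h'⟩
      · exact ⟨hm', hde, fun he w hw => (h he w hw).trans hlt,
          fun he w hw => (h' he w hw).trans hlt⟩
    · rw [component_eq_restrictSupport hJ,
        component_eq_restrictSupport (restrictScalars_purePowers hrn a),
        span_monomial_sup_restrictSupport]
      congr 1
      ext m
      simp only [Set.mem_inter_iff, Set.mem_union, Set.mem_ofPred_eq]
      constructor
      · rintro ⟨hm, rfl⟩
        by_cases hmP : m ∈ P
        · exact Or.inr ⟨hmP, rfl⟩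
        obtain ⟨hdm, hmD, hmD'⟩ := hm.resolve_left hmP
        refine Or.inl ⟨rfl, hdm, fun he w hw => ?_, fun he w hw => ?_⟩
        · by_contra hlt
          rcases (not_lt.1 hlt).eq_or_lt with heq | hlt
          · exact hmD (toLex.injective heq ▸ hw)
          · exact hmD (hD.2 w hw _ (mem_box.2 ⟨hPc m hmP (by omega), by
              exact_mod_cast he⟩) hlt)
        · by_contra hlt
          rcases (not_lt.1 hlt).eq_or_lt with heq | hlt
          · exact hmD' (toLex.injective heq ▸ hw)
          · exact hmD' (hD'.2 w hw _ (mem_box.2 ⟨hPc m hmP (by omega), by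
              exact_mod_cast he⟩) hlt)
      · rintro (⟨hme, hde, h, h'⟩ | ⟨hmP, hme⟩)
        · refine ⟨Or.inr ⟨hme ▸ hde, fun hm => ?_, fun hm => ?_⟩, hme⟩
          · exact lt_irrefl _ (h (hme ▸ (hDbox m hm).2) _ hm)
          · exact lt_irrefl _ (h' (hme ▸ (hDbox' m hm).2) _ hm)
        · exact ⟨Or.inl hmP, hme⟩
  · refine ⟨fun hm => ⟨(hDbox m hm).2, ?_⟩, fun ⟨hme, hm⟩ => ?_⟩
    · rintro (h | ⟨-, h, -⟩)
      · exact hcP m (hDbox m hm).1 h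
      · exact h hm
    · by_contra h
      refine hm (Or.inr ⟨hme.ge, h, fun h' => ?_⟩)
      have := (hDbox' m h').2
      omega
  · refine ⟨fun hm => ⟨(hDbox' m hm).2, ?_⟩, fun ⟨hme, hm⟩ => ?_⟩
    · rintro (h | ⟨-, -, h⟩)
      · exact hcP m (hDbox' m hm).1 h
      · exact h hm
    · by_contra h
      refine hm (Or.inr ⟨by omega, fun h' => ?_, h⟩)
      have := (hDbox m h').2
      omega

theorem egh_of_span_le {a : Fin r → ℕ} (hrn : r ≤ n) (hmono : Monotone a)
    {f : Fin r → MvPolynomial (Fin n) K} (hreg : IsRegSeq f)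
    (hdeg : ∀ i, (f i).IsHomogeneous (a i)) {G : Set (MvPolynomial (Fin n) K)}
    (hlin : ∀ p ∈ G, ∃ (k : ℕ) (l : Fin k → MvPolynomial (Fin n) K),
      (∀ t, (l t).IsHomogeneous 1) ∧ p = ∏ t, l t)
    (hfG : ∀ i, f i ∈ Ideal.span G) {I : Ideal (MvPolynomial (Fin n) K)} (hI : IsHomog I)
    (hGI : Ideal.span G ≤ I) : EGH hrn a I := by
  intro d
  set N := d + 2 + ∑ i, a i with hNdef
  have hN (i) : a i ≤ N :=
    (single_le_sum (fun _ _ => Nat.zero_le _) (mem_univ i)).trans (Nat.le_add_left _ _)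
  have hgood := goodH_sup_powersIdeal hrn hmono hreg hdeg hlin hfG hI hGI hN
  have hcard (e : ℕ) (he : e < N) : hq I e ≤ #(box (caps n a N) e) := by
    rw [← hq_sup_powersIdeal hI he]
    exact (hgood e).1
  obtain ⟨D, hD, hDcard⟩ := exists_isInit _ _ (hcard d (by omega))
  obtain ⟨D', hD', hDcard'⟩ := exists_isInit _ _ (hcard (d + 1) (by omega))
  have hshadow : #(shadow D') ≤ #D := by
    rw [hDcard, ← hq_sup_powersIdeal hI (show d < N by omega)]
    refine (hgood d).2 D' (by exact_mod_cast hD') ?_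
    rw [hDcard', ← hq_sup_powersIdeal hI (show d + 1 < N by omega)]
    push_cast
    rfl
  have hDD' : shadow D' ⊆ D := by
    have := hD'.shadow
    rw [Nat.cast_add, Nat.cast_one, add_sub_cancel_right] at this
    exact this.subset_of_card_le hD hshadow
  obtain ⟨J, hJ, h, h'⟩ := exists_isLPP K hrn (by omega) hD hD' hDD'
  have hd := hilb_add_hq I d
  have hd' := hilb_add_hq I (d + 1)
  exact ⟨J, hJ, by omega, by omega⟩

lemma exists_monomial_eq_prod (m : Fin n →₀ ℕ) :
    ∃ (k : ℕ) (l : Fin k → MvPolynomial (Fin n) K),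
      (∀ t, (l t).IsHomogeneous 1) ∧ monomial m 1 = ∏ t, l t := by
  induction m using Finsupp.induction_linear with
  | zero => exact ⟨0, Fin.elim0, fun t => t.elim0, by simp⟩
  | add m m' h h' =>
    obtain ⟨k, l, hl, hm⟩ := h
    obtain ⟨k', l', hl', hm'⟩ := h'
    refine ⟨k + k', Fin.append l l', fun t => ?_, ?_⟩
    · refine Fin.addCases (fun i => ?_) (fun i => ?_) t
      · simpa using hl i
      · simpa using hl' i
    · rw [Fin.prod_univ_add]
      simp [← hm, ← hm', monomial_mul]
  | single i e =>
    exact ⟨e, fun _ => X i, fun _ => isHomogeneous_X _ _, by simp [X_pow_eq_monomial]⟩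

end Assembly

end CappedLex

/-- **Abedelfatah.** Let `F ⊆ A = K[x_1,…,x_n]` be generated by a homogeneous regular
sequence of degree `a`, and assume `F ⊆ P` where `P` is generated by products of linear
forms.  Then every homogeneous ideal containing `P` satisfies `EGH_a`.  In particular,
every monomial ideal containing a homogeneous regular sequence of degree `a`
satisfies `EGH_a`. -/
theorem abedelfatah {K : Type*} [Field K] {n r : ℕ} (hrn : r ≤ n)
    (a : Fin r → ℕ) (hpos : ∀ i, 0 < a i) (hmono : Monotone a)
    (f : Fin r → MvPolynomial (Fin n) K)
    (hreg : IsRegSeq f) (hdeg : ∀ i, (f i).IsHomogeneous (a i))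
    (P : Ideal (MvPolynomial (Fin n) K)) (G : Set (MvPolynomial (Fin n) K))
    (hPG : P = Ideal.span G)
    (hlin : ∀ p ∈ G, ∃ (k : ℕ) (l : Fin k → MvPolynomial (Fin n) K),
      (∀ t, (l t).IsHomogeneous 1) ∧ p = ∏ t, l t)
    (hfP : Ideal.span (Set.range f) ≤ P) :
    (∀ I : Ideal (MvPolynomial (Fin n) K), IsHomog I → P ≤ I → EGH hrn a I) ∧
    (∀ I : Ideal (MvPolynomial (Fin n) K), IsMonomialIdeal I → ContainsRegSeq a I →
      EGH hrn a I) := by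
  have hfG (i : Fin r) : f i ∈ Ideal.span G := hPG ▸ hfP (Ideal.subset_span ⟨i, rfl⟩)
  refine ⟨fun I hI hPI => CappedLex.egh_of_span_le hrn hmono hreg hdeg hlin hfG hI (hPG ▸ hPI), ?_⟩
  rintro I ⟨M, rfl⟩ ⟨g, hg, hgreg, hgdeg⟩
  refine CappedLex.egh_of_span_le hrn hmono hgreg hgdeg ?_ hg
    (CappedLex.isHomog_span ?_) le_rfl
  · rintro _ ⟨m, -, rfl⟩
    exact CappedLex.exists_monomial_eq_prod m
  · rintro _ ⟨m, -, rfl⟩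
    exact ⟨m.degree, isHomogeneous_monomial _ rfl⟩
end
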